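/- arXiv:1306.1794 — 8 statements merged into one kernel-verified Lean document; each statement's English description precedes it below -/
import Mathlib

section
/- Let L be a one-sorted first-order language (possibly with both function and relation symbols) and let Φ(x) be an L-formula in one free variable. Let 𝓛 be any extension of the language of Boolean algebras {0, 1, ∧, ∨, complement} containing a unary predicate Fin. Then for every L(𝔅_𝓛)-formula θ(x₁,…,xₙ) there exists a quantifier-free L(𝔅_𝓛)-formula θ′(x₁,…,xₙ) such that for every index set I, every admissible 𝓛-structure 𝔅_𝓛 on the powerset of I, and every family (M_i)_{i∈I} of L-structures in which Φ(M_i) is an L-substructure of M_i for each i, the restricted product Π^(Φ) satisfies ∀x̄ (θ(x̄) ↔ θ′(x̄)). -/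
open FirstOrder Language Structure

universe u v w x

/-- The language `L(𝔅_𝓛)`: it has the function symbols of `L`, and, for each `𝓛`-formula
`Ψ(z₁,…,z_m)` and each `m`-tuple of `L`-formulas `Φ₁,…,Φ_m` in common free variables
`x₁,…,x_s`, an `s`-ary relation symbol `Ψ ∘ ⟨Φ₁,…,Φ_m⟩`. -/
def GenLang (L LB : Language) : Language where
  Functions := L.Functions
  Relations s := Σ m : ℕ, LB.Formula (Fin m) × (Fin m → L.Formula (Fin s))

variable {L LB : Language}

/-- The generalized-product `L(𝔅_𝓛)`-structure on the product `Π = ∏ᵢ Mᵢ`: functions of `L`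
are interpreted coordinatewise, and the relation symbol `Ψ ∘ ⟨Φ₁,…,Φ_m⟩` holds of
`f₁,…,f_s` iff `𝔅_𝓛 ⊨ Ψ([[Φ₁(f̄)]],…,[[Φ_m(f̄)]])`, where
`[[Θ(f̄)]] = {i : Mᵢ ⊨ Θ(f₁(i),…,f_s(i))}` is the Boolean value. -/
def genStructure {I : Type w} (M : I → Type x) [∀ i, L.Structure (M i)]
    [LB.Structure (Set I)] : (GenLang L LB).Structure (∀ i, M i) where
  funMap {n} f a := fun i => Structure.funMap (L := L) f (fun k => a k i)
  RelMap {s} R a :=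
    R.2.1.Realize (fun j => ({i | (R.2.2 j).Realize (fun k => a k i)} : Set I))

/-- The underlying set of the restricted product `Π^(Φ)` with respect to the `L`-formula `Φ`
in one free variable: those `f ∈ ∏ᵢ Mᵢ` with `[[¬Φ(f)]]` finite. -/
def ResSet {I : Type w} (M : I → Type x) [∀ i, L.Structure (M i)]
    (φ : L.Formula (Fin 1)) : Set (∀ i, M i) :=
  {f | {i | ¬ φ.Realize (fun _ => f i)}.Finite}

/-- The restricted product `Π^(Φ)` as an `L(𝔅_𝓛)`-structure (an `L(𝔅_𝓛)`-substructure of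
the full product); the hypothesis `hcl` (which follows from each `Φ(Mᵢ)` being an
`L`-substructure of `Mᵢ`) says that the restricted product is closed under the
coordinatewise functions of `L`. -/
def resStructure {I : Type w} (M : I → Type x) [∀ i, L.Structure (M i)]
    [LB.Structure (Set I)] (φ : L.Formula (Fin 1))
    (hcl : ∀ (n : ℕ) (g : L.Functions n) (a : Fin n → ResSet M φ),
      (fun i => funMap g (fun k => (a k).1 i)) ∈ ResSet M φ) :
    (GenLang L LB).Structure (ResSet M φ) where
  funMap {n} g a := ⟨fun i => Structure.funMap (L := L) g (fun k => (a k).1 i), hcl n g a⟩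
  RelMap {s} R a :=
    R.2.1.Realize (fun j => ({i | (R.2.2 j).Realize (fun k => (a k).1 i)} : Set I))

/-- The part of admissibility of an `LB`-structure on the powerset of `I` that the elimination
uses: top element, intersection, complement and finiteness have their standard meaning. -/
structure IsAdmissible (bone : LB.Constants) (binf : LB.Functions 2) (bcompl : LB.Functions 1)
    (bfin : LB.Relations 1) (I : Type w) [LB.Structure (Set I)] : Prop where
  one : funMap bone ![] = (Set.univ : Set I)
  inf : ∀ A B : Set I, funMap binf ![A, B] = A ∩ B
  compl : ∀ A : Set I, funMap bcompl ![A] = Aᶜ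
  fin : ∀ A : Set I, RelMap bfin ![A] ↔ A.Finite

/-- The Boolean value `[[Θ(f̄)]]`. -/
def boolValue {I : Type w} {M : I → Type x} [∀ i, L.Structure (M i)] {β : Type*}
    (Θ : L.Formula β) (f : β → ∀ i, M i) : Set I :=
  {i | Θ.Realize fun b => f b i}

/-- A formula of `GenLang L LB` is reducible if, uniformly in all restricted products, it is
equivalent to an `LB`-formula evaluated at Boolean values of `L`-formulas. -/
def IsReducible.{u', v', w', x'} {L LB : FirstOrder.Language.{u', v'}} (bone : LB.Constants)
    (binf : LB.Functions 2) (bcompl : LB.Functions 1) (bfin : LB.Relations 1)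
    (φ : L.Formula (Fin 1)) {α : Type} {k : ℕ} (ψ : (GenLang L LB).BoundedFormula α k) : Prop :=
  ∃ (ι : Type) (_ : Finite ι) (Ψ : LB.Formula ι) (Θ : ι → L.Formula (α ⊕ Fin k)),
    ∀ (I : Type w') [LB.Structure (Set I)], IsAdmissible bone binf bcompl bfin I →
    ∀ (M : I → Type x') [∀ i, L.Structure (M i)]
      (hcl : ∀ (n : ℕ) (g : L.Functions n) (a : Fin n → ResSet M φ),
        (fun i => funMap g (fun j => (a j).1 i)) ∈ ResSet M φ)
      (v : α → ResSet M φ) (xs : Fin k → ResSet M φ),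
      @BoundedFormula.Realize _ _ (resStructure M φ hcl) _ _ ψ v xs ↔
        Ψ.Realize fun j => boolValue (Θ j) fun b => (Sum.elim v xs b).1

/-- The underlying `L`-term of a term of `GenLang L LB`. -/
def baseTerm {β : Type*} : (GenLang L LB).Term β → L.Term β
  | .var b => .var b
  | .func (l := l) f ts => .func (L := L) (l := l) f fun j => baseTerm (ts j)

theorem realize_baseTerm {I : Type w} (M : I → Type x) [∀ i, L.Structure (M i)]
    [LB.Structure (Set I)] (φ : L.Formula (Fin 1))
    (hcl : ∀ (n : ℕ) (g : L.Functions n) (a : Fin n → ResSet M φ),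
      (fun i => funMap g (fun j => (a j).1 i)) ∈ ResSet M φ)
    {β : Type*} (t : (GenLang L LB).Term β) (v : β → ResSet M φ) (i : I) :
    (baseTerm t).realize (fun b => (v b).1 i) =
      (@Term.realize _ _ (resStructure M φ hcl) _ v t).1 i := by
  induction t with
  | var b => rfl
  | func f ts ih =>
    change funMap (L := L) f (fun j => (baseTerm (ts j)).realize _) =
      funMap (L := L) f (fun j => _)
    congr 1
    funext j
    exact ih j

/-- Finite intersections are expressed by terms. -/
theorem exists_term_realize_eq_iInter.{u', v', w'} {LB : FirstOrder.Language.{u', v'}} (bone : LB.Constants)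
    (binf : LB.Functions 2) (bcompl : LB.Functions 1) (bfin : LB.Relations 1)
    {β κ : Type} [Finite κ] (t : κ → LB.Term β) :
    ∃ T : LB.Term β, ∀ (I : Type w') [LB.Structure (Set I)],
      IsAdmissible bone binf bcompl bfin I →
      ∀ Z : β → Set I, T.realize Z = ⋂ o, (t o).realize Z := by
  classical
  cases nonempty_fintype κ
  suffices h : ∀ s : Finset κ, ∃ T : LB.Term β, ∀ (I : Type w') [LB.Structure (Set I)],
      IsAdmissible bone binf bcompl bfin I →
      ∀ Z : β → Set I, T.realize Z = ⋂ o ∈ s, (t o).realize Z by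
    simpa using h Finset.univ
  intro s
  induction s using Finset.induction_on with
  | empty =>
    refine ⟨.func bone ![], fun I _ hI Z => ?_⟩
    rw [Term.realize, Subsingleton.elim (fun j => Term.realize Z (![] j)) ![], hI.one]
    simp
  | insert a s _ ih =>
    obtain ⟨T, hT⟩ := ih
    refine ⟨binf.apply₂ (t a) T, fun I _ hI Z => ?_⟩
    rw [Term.realize_functions_apply₂, hI.inf, hT I hI, Finset.set_biInter_insert]

/-- A section of a family of types realizing prescribed sets `Z o` as truth sets of the
predicates `P o` exists iff the prescribed truth pattern is realized at every index. -/
theorem exists_section_iff {I : Type*} {M : I → Type*} {κ : Type*} (P : κ → ∀ i, M i → Prop)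
    (Z : κ → Set I) :
    (∃ f : ∀ i, M i, ∀ o, {i | P o i (f i)} = Z o) ↔
      ∀ S : Set κ, {i | ∀ o, i ∈ Z o ↔ o ∈ S} ⊆ {i | ∃ y, ∀ o, P o i y ↔ o ∈ S} := by
  constructor
  · rintro ⟨f, hf⟩ S i hi
    refine ⟨f i, fun o => ?_⟩
    rw [← hi o, ← hf o]
    rfl
  · intro h
    have h' : ∀ i, ∃ y, ∀ o, P o i y ↔ i ∈ Z o := fun i =>
      h {o | i ∈ Z o} (fun _ => Iff.rfl)
    choose f hf using h'
    exact ⟨f, fun o => Set.ext fun i => hf i o⟩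

/-- The formula stating that some `y` satisfies exactly those `Θ o` with `o ∈ S`. -/
theorem exists_formula_realize_pattern.{u', v', x'} {L : FirstOrder.Language.{u', v'}} {β κ : Type}
    [Finite κ] (Θ : κ → L.Formula (β ⊕ Unit)) (S : Set κ) :
    ∃ Ξ : L.Formula β, ∀ (N : Type x') [L.Structure N] (v : β → N),
      Ξ.Realize v ↔ ∃ y : N, ∀ o, (Θ o).Realize (Sum.elim v fun _ => y) ↔ o ∈ S := by
  classical
  refine ⟨Formula.iExs Unit (Formula.iInf fun o => if o ∈ S then Θ o else (Θ o).not),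
    fun N _ v => ?_⟩
  rw [Formula.realize_iExs, (Equiv.funUnique Unit N).exists_congr_left]
  refine exists_congr fun y => ?_
  rw [Formula.realize_iInf]
  refine forall_congr' fun o => ?_
  have : (Sum.elim v ((Equiv.funUnique Unit N).symm y)) = Sum.elim v fun _ => y := rfl
  rw [this]
  split_ifs with h <;> simp [h]

/-- The quantification over tuples of sets that reflects a universal quantifier over the
restricted product: `Ψ` holds of all `Z` which respect the bounds `B` on their cells and
whose distinguished coordinate is cofinite. -/
theorem exists_formula_forall_cells.{u', v', w'} {LB : FirstOrder.Language.{u', v'}} (bone : LB.Constants)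
    (binf : LB.Functions 2) (bcompl : LB.Functions 1) (bfin : LB.Relations 1)
    {ι : Type} [Finite ι] (Ψ : LB.Formula ι) :
    ∃ Ψ' : LB.Formula (Set (Option ι)), ∀ (I : Type w') [LB.Structure (Set I)],
      IsAdmissible bone binf bcompl bfin I → ∀ B : Set (Option ι) → Set I,
      Ψ'.Realize B ↔ ∀ Z : Option ι → Set I,
        (∀ S : Set (Option ι), {i | ∀ o, i ∈ Z o ↔ o ∈ S} ⊆ B S) →
        (Z none)ᶜ.Finite → Ψ.Realize fun j => Z (some j) := by
  classical
  choose cell hcell using fun S : Set (Option ι) =>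
    exists_term_realize_eq_iInter.{u', v', w'} bone binf bcompl bfin
      fun o => if o ∈ S then (Term.var (.inr o) : LB.Term (Set (Option ι) ⊕ Option ι))
        else bcompl.apply₁ (.var (.inr o))
  refine ⟨Formula.iAlls (Option ι)
    ((Formula.iInf fun S => (binf.apply₂ (cell S) (.var (.inl S))).equal (cell S)).imp
      ((bfin.formula₁ (bcompl.apply₁ (.var (.inr none)))).imp
        (Ψ.relabel fun j => .inr (some j)))), fun I _ hI B => ?_⟩
  have hc (Z : Option ι → Set I) (S : Set (Option ι)) :
      (cell S).realize (Sum.elim B Z) = {i | ∀ o, i ∈ Z o ↔ o ∈ S} := by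
    rw [hcell S I hI]
    ext i
    simp only [Set.mem_iInter, Set.mem_ofPred_eq]
    refine forall_congr' fun o => ?_
    split_ifs with h <;> simp [h, hI.compl]
  rw [Formula.realize_iAlls]
  refine forall_congr' fun Z => ?_
  change ((Formula.iInf _).Realize (Sum.elim B Z) →
    (bfin.formula₁ _).Realize (Sum.elim B Z) → (Ψ.relabel _).Realize (Sum.elim B Z)) ↔ _
  rw [Formula.realize_iInf, Formula.realize_rel₁, hI.fin, Formula.realize_relabel]
  simp only [Formula.realize_equal, Term.realize_functions_apply₂, Term.realize_functions_apply₁,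
    hI.inf, hI.compl, hc, Term.realize_var, Sum.elim_inl, Sum.elim_inr, Set.inter_eq_left]
  rfl

section Reduction

variable {L LB : FirstOrder.Language.{u, v}} {bone : LB.Constants} {binf : LB.Functions 2}
  {bcompl : LB.Functions 1} {bfin : LB.Relations 1} {φ : L.Formula (Fin 1)} {α : Type} {k : ℕ}

theorem IsReducible.falsum :
    IsReducible.{u, v, w, x} bone binf bcompl bfin φ
      (BoundedFormula.falsum : (GenLang L LB).BoundedFormula α k) :=
  ⟨Empty, inferInstance, ⊥, Empty.elim, fun _ _ _ _ _ _ _ _ => Iff.rfl⟩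

theorem IsReducible.equal (t₁ t₂ : (GenLang L LB).Term (α ⊕ Fin k)) :
    IsReducible.{u, v, w, x} bone binf bcompl bfin φ (BoundedFormula.equal t₁ t₂) := by
  refine ⟨Unit, inferInstance, (Term.var ()).equal (.func bone ![]),
    fun _ => (baseTerm t₁).equal (baseTerm t₂), fun I _ hI M _ hcl v xs => ?_⟩
  rw [Formula.realize_equal, Term.realize_var, Term.realize,
    Subsingleton.elim (fun j => Term.realize _ (![] j)) ![], hI.one, Set.eq_univ_iff_forall]
  simp only [boolValue, Set.mem_ofPred_eq, Formula.realize_equal, realize_baseTerm M φ hcl]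
  exact Subtype.ext_iff.trans funext_iff

theorem IsReducible.rel {l : ℕ} (R : (GenLang L LB).Relations l)
    (ts : Fin l → (GenLang L LB).Term (α ⊕ Fin k)) :
    IsReducible.{u, v, w, x} bone binf bcompl bfin φ (BoundedFormula.rel R ts) := by
  refine ⟨Fin R.1, inferInstance, R.2.1,
    fun j => (R.2.2 j).subst fun a => baseTerm (ts a), fun I _ hI M _ hcl v xs => ?_⟩
  have h (j : Fin R.1) : boolValue ((R.2.2 j).subst fun a => baseTerm (ts a))
      (fun b => (Sum.elim v xs b).1) =
      {i | (R.2.2 j).Realize fun a =>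
        (@Term.realize _ _ (resStructure M φ hcl) _ (Sum.elim v xs) (ts a)).1 i} := by
    ext i
    simp only [boolValue, Set.mem_ofPred_eq, Formula.Realize, BoundedFormula.realize_subst,
      realize_baseTerm M φ hcl]
  simp only [h]
  rfl

theorem IsReducible.imp {ψ₁ ψ₂ : (GenLang L LB).BoundedFormula α k}
    (h₁ : IsReducible.{u, v, w, x} bone binf bcompl bfin φ ψ₁)
    (h₂ : IsReducible.{u, v, w, x} bone binf bcompl bfin φ ψ₂) :
    IsReducible.{u, v, w, x} bone binf bcompl bfin φ (ψ₁.imp ψ₂) := by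
  obtain ⟨ι₁, _, Ψ₁, Θ₁, h₁⟩ := h₁
  obtain ⟨ι₂, _, Ψ₂, Θ₂, h₂⟩ := h₂
  refine ⟨ι₁ ⊕ ι₂, inferInstance, (Ψ₁.relabel Sum.inl).imp (Ψ₂.relabel Sum.inr),
    Sum.elim Θ₁ Θ₂, fun I _ hI M _ hcl v xs => ?_⟩
  rw [Formula.realize_imp, Formula.realize_relabel, Formula.realize_relabel]
  exact imp_congr (h₁ I hI M hcl v xs) (h₂ I hI M hcl v xs)

theorem IsReducible.all {ψ : (GenLang L LB).BoundedFormula α (k + 1)}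
    (h : IsReducible.{u, v, w, x} bone binf bcompl bfin φ ψ) :
    IsReducible.{u, v, w, x} bone binf bcompl bfin φ ψ.all := by
  obtain ⟨ι, _, Ψ, Θ, h⟩ := h
  obtain ⟨Ψ', hΨ'⟩ := exists_formula_forall_cells.{u, v, w} bone binf bcompl bfin Ψ
  let Θ' : Option ι → L.Formula ((α ⊕ Fin k) ⊕ Unit) := fun o =>
    o.elim (φ.relabel fun _ => .inr ()) fun j => (Θ j).relabel
      (Sum.elim (fun a => .inl (.inl a)) (Fin.lastCases (.inr ()) fun b => .inl (.inr b)))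
  choose Ξ hΞ using exists_formula_realize_pattern.{u, v, x} Θ'
  refine ⟨Set (Option ι), inferInstance, Ψ', Ξ, fun I _ hI M _ hcl v xs => ?_⟩
  rw [hΨ' I hI]
  let P : Option ι → ∀ i, M i → Prop := fun o i y =>
    (Θ' o).Realize (Sum.elim (fun b => (Sum.elim v xs b).1 i) fun _ => y)
  have hB (S : Set (Option ι)) : boolValue (Ξ S) (fun b => (Sum.elim v xs b).1) =
      {i | ∃ y, ∀ o, P o i y ↔ o ∈ S} := Set.ext fun i => hΞ S (M i) _
  simp only [hB]
  have hnone (f : ∀ i, M i) :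
      {i | P none i (f i)} = {i | φ.Realize fun _ => f i} :=
    Set.ext fun i => Formula.realize_relabel
  have hsome (f : ResSet M φ) (j : ι) : {i | P (some j) i (f.1 i)} =
      boolValue (Θ j) fun b => (Sum.elim v (Fin.snoc xs f : Fin (k + 1) → ResSet M φ) b).1 := by
    ext i
    refine Formula.realize_relabel.trans (iff_of_eq ?_)
    change (Θ j).Realize _ = (Θ j).Realize _
    congr 1
    funext b
    rcases b with a | b
    · rfl
    · induction b using Fin.lastCases <;> simp
  have key : (∀ f : ResSet M φ,
      @BoundedFormula.Realize _ _ (resStructure M φ hcl) _ _ ψ v (Fin.snoc xs f)) ↔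
      ∀ Z : Option ι → Set I, (∃ f : ∀ i, M i, ∀ o, {i | P o i (f i)} = Z o) →
        (Z none)ᶜ.Finite → Ψ.Realize fun j => Z (some j) := by
    constructor
    · rintro hf Z ⟨f, hZ⟩ hfin
      have hmem : f ∈ ResSet M φ := by
        rw [← hZ, hnone] at hfin
        exact hfin
      have := (h I hI M hcl v _).1 (hf ⟨f, hmem⟩)
      simpa only [← hsome, hZ] using this
    · intro hZ f
      rw [h I hI M hcl v]
      simp only [← hsome]
      refine hZ (fun o => {i | P o i (f.1 i)}) ⟨f.1, fun _ => rfl⟩ ?_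
      rw [hnone]
      exact f.2
  refine Iff.trans key (forall_congr' fun Z => ?_)
  rw [exists_section_iff]

theorem isReducible (ψ : (GenLang L LB).BoundedFormula α k) :
    IsReducible.{u, v, w, x} bone binf bcompl bfin φ ψ := by
  induction ψ with
  | falsum => exact .falsum
  | equal t₁ t₂ => exact .equal t₁ t₂
  | rel R ts => exact .rel R ts
  | imp _ _ ih₁ ih₂ => exact ih₁.imp ih₂
  | all _ ih => exact ih.all

end Reduction

/-- Let `L` be a one-sorted language, `Φ(x)` an `L`-formula in one free
variable, and `𝓛` any extension of the language of Boolean algebras with a unary predicate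
`Fin`.  For every `L(𝔅_𝓛)`-formula `θ(x₁,…,xₙ)` there is a quantifier-free
`L(𝔅_𝓛)`-formula `θ'(x₁,…,xₙ)` such that for every index set `I`, every admissible
`𝓛`-structure on the powerset of `I` (Boolean symbols interpreted set-theoretically, `Fin`
as finiteness), and every family `(Mᵢ)` of `L`-structures in which `Φ(Mᵢ)` is an
`L`-substructure of `Mᵢ`, the restricted product `Π^(Φ)` satisfies `∀ x̄ (θ(x̄) ↔ θ'(x̄))`. -/
theorem restricted_product_quantifier_elimination
    (L LB : FirstOrder.Language.{u, v}) (bzero bone : LB.Constants) (binf bsup : LB.Functions 2)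
    (bcompl : LB.Functions 1) (bfin : LB.Relations 1)
    (φ : L.Formula (Fin 1)) (n : ℕ) (θ : (GenLang L LB).Formula (Fin n)) :
    ∃ θ' : (GenLang L LB).Formula (Fin n), θ'.IsQF ∧
      ∀ (I : Type w) (_ : LB.Structure (Set I)),
        funMap bzero ![] = (∅ : Set I) →
        funMap bone ![] = (Set.univ : Set I) →
        (∀ A B : Set I, funMap binf ![A, B] = A ∩ B) →
        (∀ A B : Set I, funMap bsup ![A, B] = A ∪ B) →
        (∀ A : Set I, funMap bcompl ![A] = Aᶜ) →
        (∀ A : Set I, RelMap bfin ![A] ↔ A.Finite) →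
        ∀ (M : I → Type x) (_ : ∀ i, L.Structure (M i)),
          -- `Φ(Mᵢ)` is an `L`-substructure of `Mᵢ` for each `i` :
          (∀ (i : I) (k : ℕ) (g : L.Functions k) (a : Fin k → M i),
            (∀ j, φ.Realize (fun _ => a j)) → φ.Realize (fun _ => funMap g a)) →
          ∀ (hcl : ∀ (k : ℕ) (g : L.Functions k) (a : Fin k → ResSet M φ),
            (fun i => funMap g (fun j => (a j).1 i)) ∈ ResSet M φ),
          ∀ v : Fin n → ResSet M φ,
            (@Formula.Realize _ _ (resStructure M φ hcl) _ θ v ↔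
              @Formula.Realize _ _ (resStructure M φ hcl) _ θ' v) := by
  obtain ⟨ι, _, Ψ, Θ, h⟩ :=
    isReducible.{u, v, w, x} (bone := bone) (binf := binf) (bcompl := bcompl) (bfin := bfin)
      (φ := φ) θ
  obtain ⟨m, ⟨e⟩⟩ := Finite.exists_equiv_fin ι
  let R : (GenLang L LB).Relations n :=
    ⟨m, Ψ.relabel e, fun j => (Θ (e.symm j)).relabel (Sum.elim id finZeroElim)⟩
  refine ⟨R.formula fun j => .var j, (BoundedFormula.IsAtomic.rel _ _).isQF, ?_⟩
  intro I _ _ hone hinf _ hcompl hfin M _ _ hcl v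
  refine (h I ⟨hone, hinf, hcompl, hfin⟩ M hcl v default).trans ?_
  rw [@Formula.realize_rel _ _ (resStructure M φ hcl)]
  refine Iff.trans (iff_of_eq ?_) Formula.realize_relabel.symm
  congr 1
  funext j
  change _ = boolValue ((Θ (e.symm (e j))).relabel (Sum.elim id finZeroElim))
    fun b => (v b).1
  rw [e.symm_apply_apply]
  ext i
  refine Iff.trans (iff_of_eq ?_) Formula.realize_relabel.symm
  change (Θ j).Realize _ = (Θ j).Realize _
  congr 1
  funext b
  rcases b with a | b
  · rfl
  · exact b.elim0
end

section
/- Let K be a Henselian valued field whose residue field k is a model of the theory of finite fields. Then (i) every element of T⁺(K) has value 0, i.e., is a unit of the valuation ring O_K; and (ii) if α ∈ K has v(α) = 0 and the residue of α lies in T⁺(k), then α ∈ T⁺(K). -/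
open Polynomial in
/-- In a Henselian local ring, every element of the maximal ideal has the form `y ^ 2 + y`. -/
theorem HenselianLocalRing.exists_eq_sq_add_self {R : Type*} [CommRing R] [HenselianLocalRing R]
    {x : R} (hx : x ∈ IsLocalRing.maximalIdeal R) : ∃ y, x = y ^ 2 + y := by
  have hmonic : (X ^ 2 + X - C x : R[X]).Monic := by monicity!
  obtain ⟨y, hy, -⟩ := HenselianLocalRing.is_henselian (X ^ 2 + X - C x : R[X]) hmonic 0
    (by simpa using hx) (by simp)
  refine ⟨y, ?_⟩
  simp only [IsRoot.def, eval_sub, eval_add, eval_pow, eval_X, eval_C] at hy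
  exact (sub_eq_zero.mp hy).symm

namespace Valuation

variable {K Γ₀ : Type*} [Field K] [LinearOrderedCommGroupWithZero Γ₀] (v : Valuation K Γ₀)

theorem exists_eq_sq_add_self [HenselianLocalRing v.valuationSubring] {x : K} (hx : v x < 1) :
    ∃ y, x = y ^ 2 + y := by
  have hmem : (⟨x, (v.mem_valuationSubring_iff x).mpr hx.le⟩ : v.valuationSubring) ∈
      IsLocalRing.maximalIdeal v.valuationSubring := by
    rw [IsLocalRing.mem_maximalIdeal, mem_nonunits_iff]
    intro hu
    obtain ⟨b, hb⟩ := hu.exists_right_inv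
    have hxb : v x * v (b : K) = 1 := by
      rw [← map_mul, ← map_one v]
      exact congrArg v (congrArg Subtype.val hb)
    have hb1 : v (b : K) ≤ 1 := (v.mem_valuationSubring_iff _).mp b.2
    exact (mul_lt_one_of_lt_of_le hx hb1).ne hxb
  obtain ⟨y, hy⟩ := HenselianLocalRing.exists_eq_sq_add_self hmem
  exact ⟨y, congrArg Subtype.val hy⟩

theorem le_one_of_sq_add_self_le_one {y : K} (h : v (y ^ 2 + y) ≤ 1) : v y ≤ 1 := by
  by_contra! hy
  have hlt : v y < v (y ^ 2) := by
    rw [map_pow]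
    exact lt_self_pow₀ hy one_lt_two
  rw [map_add_eq_of_lt_left v hlt] at h
  exact (hy.trans hlt).not_ge h

theorem exists_residue_eq_sq_add_self (a : v.valuationSubring)
    (h : ∃ y, (a : K) = y ^ 2 + y) :
    ∃ z, IsLocalRing.residue v.valuationSubring a = z ^ 2 + z := by
  obtain ⟨y, hy⟩ := h
  have hy1 : v y ≤ 1 := v.le_one_of_sq_add_self_le_one <|
    hy ▸ (v.mem_valuationSubring_iff _).mp a.2
  let y' : v.valuationSubring := ⟨y, (v.mem_valuationSubring_iff y).mpr hy1⟩
  have ha : a = y' ^ 2 + y' := Subtype.ext hy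
  exact ⟨IsLocalRing.residue _ y', by rw [ha, map_add, map_pow]⟩

end Valuation


open FirstOrder Language

/-- For a field `F`, `Tplus F` is the set of nonzero `x` such that neither `x` nor `x⁻¹`
is of the form `y² + y`. -/
def Tplus (F : Type*) [Field F] : Set F :=
  {x | x ≠ 0 ∧ (¬ ∃ y, x = y ^ 2 + y) ∧ (¬ ∃ y, x⁻¹ = y ^ 2 + y)}

/-- Satisfaction of a ring-language sentence in a ring, via the canonical
`Language.ring.Structure` coming from the ring operations. -/
def RingSat (R : Type*) [Add R] [Mul R] [Neg R] [One R] [Zero R]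
    (σ : Language.ring.Sentence) : Prop :=
  @Sentence.Realize _ R (FirstOrder.Ring.compatibleRingOfRing R).toStructure σ

/-- A field `k` is a model of the theory of finite fields if it satisfies every first-order
sentence of the language of rings that holds in all finite fields. -/
def ModelOfTheoryOfFiniteFields (k : Type*) [Field k] : Prop :=
  ∀ σ : Language.ring.Sentence,
    (∀ (F : Type) [Field F] [Fintype F], RingSat F σ) → RingSat k σ

/-- Let `K` be a Henselian valued field whose residue field `k` is a model of
the theory of finite fields.  Then (i) every element of `T⁺(K)` has value `0` (i.e. is a unit of
the valuation ring), and (ii) if `v α = 0` and the residue of `α` lies in `T⁺(k)`, then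
`α ∈ T⁺(K)`.  (Valuations are written multiplicatively: `v x = 0` additively is `v x = 1`.) -/
theorem tplus_units_and_lift {K : Type*} [Field K] {Γ₀ : Type*}
    [LinearOrderedCommGroupWithZero Γ₀] (v : Valuation K Γ₀)
    [HenselianLocalRing v.valuationSubring]
    (hk : ModelOfTheoryOfFiniteFields (IsLocalRing.ResidueField v.valuationSubring)) :
    (∀ x ∈ Tplus K, v x = 1) ∧
    (∀ (α : K) (hα : v α = 1),
      IsLocalRing.residue v.valuationSubring ⟨α, (v.mem_valuationSubring_iff α).mpr hα.le⟩ ∈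
        Tplus (IsLocalRing.ResidueField v.valuationSubring) →
      α ∈ Tplus K) := by
  refine ⟨fun x ⟨hx0, hx, hx'⟩ => ?_, fun α hα ⟨_, h, h'⟩ => ?_⟩
  · rcases lt_trichotomy (v x) 1 with hlt | heq | hgt
    · exact absurd (v.exists_eq_sq_add_self hlt) hx
    · exact heq
    · refine absurd (v.exists_eq_sq_add_self ?_) hx'
      rw [map_inv₀]
      exact inv_lt_one_of_one_lt₀ hgt
  · have hα0 : α ≠ 0 := v.ne_zero_iff.mp (hα ▸ one_ne_zero)
    have hαinv : v α⁻¹ ≤ 1 := by rw [map_inv₀, hα, inv_one]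
    refine ⟨hα0, fun hy => h (v.exists_residue_eq_sq_add_self _ hy), fun hy => h' ?_⟩
    obtain ⟨z, hz⟩ := v.exists_residue_eq_sq_add_self
      ⟨α⁻¹, (v.mem_valuationSubring_iff _).mpr hαinv⟩ hy
    refine ⟨z, ?_⟩
    rw [← hz]
    refine inv_eq_of_mul_eq_one_right ?_
    rw [← map_mul, ← map_one (IsLocalRing.residue v.valuationSubring)]
    exact congrArg _ (Subtype.ext (mul_inv_cancel₀ hα0))
end

section
/- There exists a positive integer N such that for every Henselian valued field K whose residue field k is a model of the theory of finite fields and has at least N elements, the valuation ring satisfies O_K = {a + b + c·d : a, b, c, d ∈ T⁺(K)}. -/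
open FirstOrder Language

section Incidence

open Finset

/-- A point-line incidence bound over a finite field: a set of more than `q ^ (3 / 4)` elements
satisfies `A + A + A * A = F`. -/
theorem exists_add_add_mul_of_card_pow_lt {F : Type*} [Field F] [Fintype F] (A : Finset F)
    (hA : Fintype.card F ^ 3 < A.card ^ 4) (x : F) :
    ∃ a ∈ A, ∃ b ∈ A, ∃ c ∈ A, ∃ d ∈ A, x = a + b + c * d := by
  classical
  by_contra! hne
  let P : Finset (F × F) := A ×ˢ A
  let r : F × F → ℕ := fun l => ∑ p ∈ P, if p.2 + l.1 * p.1 = l.2 then 1 else 0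
  set q := Fintype.card F with hq
  have hP : P.card = A.card ^ 2 := by simp [P, sq]
  have hr : ∑ l, r l = q * P.card := by
    simp only [r]
    rw [sum_comm]
    have : ∀ p ∈ P, (∑ l : F × F, if p.2 + l.1 * p.1 = l.2 then 1 else 0) = q := by
      intro p _
      rw [Fintype.sum_prod_type]
      simp [hq]
    rw [sum_congr rfl this]
    simp [mul_comm]
  have hr2 : ∑ l, r l ^ 2 ≤ q * P.card + P.card ^ 2 := by
    have h1 : ∀ l, r l ^ 2 = ∑ p ∈ P, ∑ p' ∈ P,
        if p.2 + l.1 * p.1 = l.2 ∧ p'.2 + l.1 * p'.1 = l.2 then 1 else 0 := by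
      intro l
      simp only [r]
      rw [sq, sum_mul_sum]
      refine sum_congr rfl fun p _ => sum_congr rfl fun p' _ => ?_
      split_ifs <;> simp_all
    have h2 : ∀ p p' : F × F, (∑ l : F × F,
        if p.2 + l.1 * p.1 = l.2 ∧ p'.2 + l.1 * p'.1 = l.2 then 1 else 0) ≤
          (if p = p' then q else 0) + 1 := by
      intro p p'
      rw [← card_filter]
      split_ifs with h
      · subst h
        refine le_trans ?_ (Nat.le_succ _)
        rw [hq, ← card_univ]
        refine card_le_card_of_injOn Prod.fst (fun _ _ => by simp) ?_
        rintro ⟨c, e⟩ h ⟨c', e'⟩ h' hc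
        simp at h h' hc
        subst hc
        simp [← h, ← h']
      · rw [zero_add, card_le_one]
        rintro ⟨c, e⟩ hl ⟨c', e'⟩ hl'
        simp at hl hl'
        obtain ⟨h1, h2⟩ := hl
        obtain ⟨h3, h4⟩ := hl'
        have hd : p.1 ≠ p'.1 := by
          intro hd
          apply h
          refine Prod.ext hd ?_
          rw [← h2, hd] at h1
          exact add_right_cancel h1
        have : (c - c') * (p.1 - p'.1) = 0 := by linear_combination h1 - h2 - h3 + h4
        have hc : c = c' := by
          rcases mul_eq_zero.mp this with h | h
          · exact sub_eq_zero.mp h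
          · exact absurd (sub_eq_zero.mp h) hd
        subst hc
        simp [← h1, ← h3]
    calc ∑ l, r l ^ 2 = ∑ p ∈ P, ∑ p' ∈ P, ∑ l : F × F,
          (if p.2 + l.1 * p.1 = l.2 ∧ p'.2 + l.1 * p'.1 = l.2 then 1 else 0) := by
          rw [sum_congr rfl fun l _ => h1 l, sum_comm]
          exact sum_congr rfl fun p _ => sum_comm
      _ ≤ ∑ p ∈ P, ∑ p' ∈ P, ((if p = p' then q else 0) + 1) :=
          sum_le_sum fun p _ => sum_le_sum fun p' _ => h2 p p'
      _ = q * P.card + P.card ^ 2 := by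
          simp only [sum_add_distrib, sum_ite_eq]
          simp only [← sum_filter, filter_mem_eq_inter, inter_self]
          simp [sq, mul_comm]
  have hvar : ∑ l : F × F, ((q : ℤ) * r l - P.card) ^ 2 ≤ (q : ℤ) ^ 3 * P.card := by
    have e1 : ∑ l : F × F, ((q : ℤ) * r l - P.card) ^ 2 =
        (q : ℤ) ^ 2 * (∑ l, r l ^ 2 : ℕ) - 2 * q * P.card * (∑ l, r l : ℕ)
          + q ^ 2 * P.card ^ 2 := by
      have : ∀ l : F × F, ((q : ℤ) * r l - P.card) ^ 2 =
        (q : ℤ) ^ 2 * (r l : ℤ) ^ 2 - 2 * q * P.card * r l + (P.card : ℤ) ^ 2 := fun l => by ring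
      simp only [this, sum_add_distrib, sum_sub_distrib, ← mul_sum]
      simp only [sum_const, card_univ, Fintype.card_prod, ← hq, nsmul_eq_mul]
      push_cast
      ring
    rw [e1, hr]
    have := mul_le_mul_of_nonneg_left (Int.ofNat_le.mpr hr2) (sq_nonneg (q : ℤ))
    push_cast at this ⊢
    nlinarith
  have hlow : (P.card : ℤ) * (P.card : ℤ) ^ 2 ≤
      ∑ l : F × F, ((q : ℤ) * r l - P.card) ^ 2 := by
    let L : Finset (F × F) := P.image fun p => (p.1, x - p.2)
    have hL : L.card = P.card := by
      refine card_image_of_injective _ ?_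
      rintro ⟨a, b⟩ ⟨c, d⟩ h
      simpa using h
    calc (P.card : ℤ) * (P.card : ℤ) ^ 2 = ∑ l ∈ L, (P.card : ℤ) ^ 2 := by simp [hL]
      _ = ∑ l ∈ L, ((q : ℤ) * r l - P.card) ^ 2 := by
          refine sum_congr rfl fun l hl => ?_
          obtain ⟨⟨c, b⟩, hcb, rfl⟩ := mem_image.mp hl
          have hcb := mem_product.mp hcb
          have : r (c, x - b) = 0 := by
            refine sum_eq_zero fun p hp => ?_
            have hp := mem_product.mp hp
            refine if_neg fun h => hne p.2 hp.2 b hcb.2 c hcb.1 p.1 hp.1 ?_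
            simp only at h
            linear_combination -h
          simp [this]
      _ ≤ _ := sum_le_sum_of_subset_of_nonneg (subset_univ _) fun _ _ _ => sq_nonneg _
  have key := hlow.trans hvar
  norm_cast at key
  rw [hP] at key
  have hpos : 0 < A.card ^ 2 := by
    rcases Nat.eq_zero_or_pos A.card with h | h
    · simp [h] at hA
    · positivity
  have : A.card ^ 4 ≤ q ^ 3 := by
    refine Nat.le_of_mul_le_mul_right ?_ hpos
    calc A.card ^ 4 * A.card ^ 2 = A.card ^ 2 * (A.card ^ 2) ^ 2 := by ring
      _ ≤ _ := key
  omega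

end Incidence

section ArtinSchreier

open Finset Polynomial

/-- A form of Stepanov's method: a polynomial vanishing to order two on `S` has degree at least
`2 * #S`. -/
theorem two_mul_card_le_natDegree {F : Type*} [Field F] {P : F[X]} (hP : P ≠ 0) (S : Finset F)
    (h : ∀ x ∈ S, P.eval x = 0 ∧ P.derivative.eval x = 0) : 2 * S.card ≤ P.natDegree := by
  classical
  have hle : 2 • S.val ≤ P.roots := by
    rw [Multiset.le_iff_count]
    intro a
    rw [Multiset.count_nsmul, count_roots]
    by_cases ha : a ∈ S
    · rw [Multiset.count_eq_one_of_mem S.nodup ha]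
      exact (one_lt_rootMultiplicity_iff_isRoot hP).mpr ⟨(h a ha).1, (h a ha).2⟩
    · rw [Multiset.count_eq_zero_of_notMem ha]
      simp
  have := Multiset.card_le_card hle
  rw [Multiset.card_nsmul] at this
  exact this.trans (card_roots' P)

theorem two_mul_card_image_le {F : Type*} [Field F] [Fintype F] [DecidableEq F] :
    2 * (univ.image fun y : F => y ^ 2 + y).card ≤ Fintype.card F + 1 := by
  let E : Finset F := univ.filter fun y => 2 * y + 1 = 0
  have hE : E.card ≤ 1 := by
    rw [card_le_one]
    intro a ha b hb
    simp [E] at ha hb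
    by_cases h2 : (2 : F) = 0
    · simp [h2] at ha
    · exact mul_left_cancel₀ h2 (by linear_combination ha - hb)
  have h1 : 2 * (Eᶜ.image fun y : F => y ^ 2 + y).card ≤ Eᶜ.card := by
    refine mul_card_image_le_card _ 2 fun b hb => ?_
    obtain ⟨y, hy, rfl⟩ := mem_image.mp hb
    have hy' : 2 * y + 1 ≠ 0 := by simpa [E] using hy
    have hne : y ≠ -1 - y := fun h => hy' (by linear_combination h)
    refine (card_pair hne).symm.trans_le (card_le_card fun z hz => ?_)
    rcases mem_insert.mp hz with rfl | hz
    · simp [hy]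
    · rw [mem_singleton.mp hz, mem_filter]
      refine ⟨?_, by ring⟩
      simp only [E, mem_compl, mem_filter, mem_univ, true_and]
      exact fun h => hy' (by linear_combination -h)
  have h2 : (univ.image fun y : F => y ^ 2 + y).card ≤
      (Eᶜ.image fun y : F => y ^ 2 + y).card + E.card := by
    have : (univ : Finset F) = Eᶜ ∪ E := by simp [union_comm]
    rw [this, image_union]
    exact (card_union_le _ _).trans (Nat.add_le_add_left card_image_le _)
  have h3 := card_compl_add_card E
  omega

/-- A lower bound for the size of `Tplus F` from an upper bound for the number of `x` such that
exactly one of `x` and `x⁻¹` is of the form `y ^ 2 + y`. -/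
theorem card_le_card_Tplus {F : Type*} [Field F] [Fintype F] (D T : Finset F)
    (hT : ∀ x, x ∈ T ↔ x ∈ Tplus F)
    (hD : ∀ x, ¬ ((∃ y, x = y ^ 2 + y) ↔ ∃ y, x⁻¹ = y ^ 2 + y) → x ∈ D) :
    Fintype.card F ≤ 2 * T.card + D.card + 1 := by
  classical
  let A : Finset F := (univ.image fun y : F => y ^ 2 + y)ᶜ
  have hA : ∀ x, x ∈ A ↔ ¬ ∃ y, x = y ^ 2 + y := fun x => by simp [A, eq_comm]
  let B : Finset F := A.image (·⁻¹)
  have hB : ∀ x, x ∈ B ↔ ¬ ∃ y, x⁻¹ = y ^ 2 + y := by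
    intro x
    rw [← hA]
    simp only [B, mem_image]
    constructor
    · rintro ⟨a, ha, rfl⟩
      simpa using ha
    · exact fun h => ⟨_, h, inv_inv x⟩
  have hBc : B.card = A.card := card_image_of_injective _ inv_injective
  have hTAB : A ∩ B = T := by
    ext x
    rw [mem_inter, hA, hB, hT]
    refine ⟨fun h => ⟨?_, h⟩, fun h => h.2⟩
    rintro rfl
    exact h.1 ⟨0, by simp⟩
  have hunion : A ∪ B ⊆ D ∪ T := by
    intro x hx
    rw [← hTAB]
    by_cases h : (∃ y, x = y ^ 2 + y) ↔ ∃ y, x⁻¹ = y ^ 2 + y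
    · simp only [mem_union, mem_inter, hA, hB] at hx ⊢
      tauto
    · exact mem_union_left _ (hD x h)
  have h1 := card_union_add_card_inter A B
  have h2 := (card_le_card hunion).trans (card_union_le _ _)
  have h3 := two_mul_card_image_le (F := F)
  have h4 : (univ.image fun y : F => y ^ 2 + y).card + A.card = Fintype.card F :=
    card_add_card_compl _
  rw [hTAB] at h1
  omega

theorem exists_artinSchreier_iff_isSquare {F : Type*} [Field F] (h2 : (2 : F) ≠ 0) (x : F) :
    (∃ y, x = y ^ 2 + y) ↔ IsSquare (1 + 4 * x) := by
  constructor
  · rintro ⟨y, rfl⟩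
    exact ⟨2 * y + 1, by ring⟩
  · rintro ⟨s, hs⟩
    refine ⟨(s - 1) / 2, ?_⟩
    field_simp
    linear_combination hs

/-- For a cubic `f` over a finite field of odd order `q`, at most `3 * (q + 1) / 4` values of `f`
are non-squares. -/
theorem four_mul_card_le_of_pow_eq_neg_one {F : Type*} [Field F] [Fintype F]
    (h2 : ringChar F ≠ 2) {f : F[X]} (hf : f.natDegree = 3) (S : Finset F)
    (hS : ∀ x ∈ S, f.eval x ^ (Fintype.card F / 2) = -1) :
    4 * S.card ≤ 3 * Fintype.card F + 3 := by
  set q := Fintype.card F with hq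
  set n := q / 2 with hn
  have hodd : q = 2 * n + 1 := by
    have := FiniteField.odd_card_of_char_ne_two h2
    omega
  have hn1 : 1 ≤ n := by
    have : 1 < q := Fintype.one_lt_card
    omega
  have h20 : (2 : F) ≠ 0 := Ring.two_ne_zero h2
  have hqF : (q : F) = 0 := FiniteField.cast_card_eq_zero F
  have hnF : 2 * (n : F) + 1 = 0 := by
    rw [← hqF, hodd]
    push_cast
    ring
  let R : F[X] := C 2 * f + (X ^ q - X) * derivative f
  let P : F[X] := C 2 * f ^ (n + 1) + R
  have hlead : (C 2 * f ^ (n + 1)).natDegree = 3 * (n + 1) := by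
    rw [natDegree_C_mul h20, natDegree_pow, hf, mul_comm]
  have hR : R.natDegree < 3 * (n + 1) := by
    have hd : (derivative f).natDegree ≤ 2 := by
      have := natDegree_derivative_le f
      omega
    have hX : (X ^ q - X : F[X]).natDegree ≤ q :=
      (natDegree_sub_le_of_le (natDegree_X_pow_le q) natDegree_X_le).trans
        (max_le le_rfl (by omega))
    have : R.natDegree ≤ max 3 (q + 2) :=
      natDegree_add_le_of_le ((natDegree_C_mul_le _ _).trans hf.le)
        (natDegree_mul_le_of_le hX hd)
    refine this.trans_lt ?_
    rw [max_lt_iff]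
    omega
  have hPdeg : P.natDegree = 3 * (n + 1) := by
    rw [natDegree_add_eq_left_of_natDegree_lt (by rwa [hlead]), hlead]
  have hP0 : P ≠ 0 := by
    intro h
    rw [h] at hPdeg
    simp at hPdeg
  have key := two_mul_card_le_natDegree hP0 S fun x hx => by
    have hF := hS x hx
    have hxq : x ^ q = x := FiniteField.pow_card x
    refine ⟨?_, ?_⟩
    · simp only [P, R, eval_add, eval_mul, eval_C, eval_pow, eval_sub, eval_X, hxq]
      rw [pow_succ, hF]
      ring
    · simp only [P, R, derivative_add, derivative_mul, derivative_pow, derivative_sub,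
        derivative_C, derivative_X, eval_add, eval_mul, eval_C, eval_pow, eval_sub, eval_X, hxq,
        eval_zero, eval_one, hqF, Nat.add_sub_cancel, hF]
      push_cast
      linear_combination (-(eval x (derivative f))) * hnF
  rw [hPdeg] at key
  omega

theorem card_Tplus_of_ringChar_ne_two {F : Type*} [Field F] [Fintype F] (h2 : ringChar F ≠ 2)
    (T : Finset F) (hT : ∀ x, x ∈ T ↔ x ∈ Tplus F) :
    Fintype.card F ≤ 8 * T.card + 19 := by
  classical
  have h20 : (2 : F) ≠ 0 := Ring.two_ne_zero h2
  have h40 : (4 : F) ≠ 0 := by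
    have : (4 : F) = 2 * 2 := by norm_num
    rw [this]
    exact mul_ne_zero h20 h20
  let f : F[X] := C 4 * X ^ 3 + C 17 * X ^ 2 + C 4 * X + C 0
  have hf : f.natDegree = 3 := natDegree_cubic h40
  have hf0 : f ≠ 0 := by
    intro h
    rw [h] at hf
    simp at hf
  have hfe : ∀ x ≠ 0, f.eval x = x ^ 2 * ((1 + 4 * x) * (1 + 4 * x⁻¹)) := by
    intro x hx
    simp [f]
    field_simp
    ring
  set n := Fintype.card F / 2 with hn
  let S : Finset F := univ.filter fun x => f.eval x ^ n = -1
  have hSc : 4 * S.card ≤ 3 * Fintype.card F + 3 :=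
    four_mul_card_le_of_pow_eq_neg_one h2 hf S fun x hx => (mem_filter.mp hx).2
  have hroots : f.roots.toFinset.card ≤ 3 :=
    (Multiset.toFinset_card_le _).trans ((card_roots' f).trans hf.le)
  have hcases : ∀ a : F, a ≠ 0 → IsSquare a ∧ a ^ n = 1 ∨ ¬ IsSquare a ∧ a ^ n = -1 := by
    intro a ha
    by_cases h : IsSquare a
    · exact Or.inl ⟨h, (FiniteField.isSquare_iff h2 ha).mp h⟩
    · refine Or.inr ⟨h, (FiniteField.pow_dichotomy h2 ha).resolve_left fun h' => h ?_⟩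
      exact (FiniteField.isSquare_iff h2 ha).mpr h'
  have hD := card_le_card_Tplus (S ∪ f.roots.toFinset) T hT fun x hx => by
    rw [exists_artinSchreier_iff_isSquare h20, exists_artinSchreier_iff_isSquare h20] at hx
    rw [mem_union]
    by_cases hfx : f.eval x = 0
    · exact Or.inr (by simpa [hf0] using hfx)
    · left
      have hx0 : x ≠ 0 := by
        rintro rfl
        simp at hx
      rw [hfe x hx0] at hfx
      have ha := left_ne_zero_of_mul (right_ne_zero_of_mul hfx)
      have hb := right_ne_zero_of_mul (right_ne_zero_of_mul hfx)
      have hx2 : (x ^ 2) ^ n = 1 :=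
        (FiniteField.isSquare_iff h2 (pow_ne_zero 2 hx0)).mp ⟨x, sq x⟩
      rw [mem_filter]
      refine ⟨mem_univ _, ?_⟩
      rw [hfe x hx0, mul_pow, mul_pow, hx2]
      rcases hcases _ ha with ⟨h1, h1'⟩ | ⟨h1, h1'⟩ <;>
        rcases hcases _ hb with ⟨h3, h3'⟩ | ⟨h3, h3'⟩ <;> simp [h1', h3'] <;> tauto
  have hu := card_union_le S f.roots.toFinset
  omega

/-- The sum `x + x ^ 2 + ⋯ + x ^ (2 ^ (n - 1))`. -/
def truncTrace {R : Type*} [CommRing R] (n : ℕ) (x : R) : R := ∑ i ∈ range n, x ^ 2 ^ i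

theorem truncTrace_sq_add {R : Type*} [CommRing R] [CharP R 2] (n : ℕ) (x : R) :
    truncTrace n x ^ 2 + x = truncTrace (n + 1) x := by
  have : Fact (Nat.Prime 2) := ⟨Nat.prime_two⟩
  simp only [truncTrace]
  rw [sum_range_succ', sum_pow_char 2]
  simp only [← pow_mul, ← pow_succ, pow_zero, pow_one]

theorem truncTrace_add {R : Type*} [CommRing R] [CharP R 2] (n : ℕ) (x y : R) :
    truncTrace n (x + y) = truncTrace n x + truncTrace n y := by
  have : Fact (Nat.Prime 2) := ⟨Nat.prime_two⟩
  simp only [truncTrace, ← sum_add_distrib]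
  exact sum_congr rfl fun i _ => add_pow_char_pow x y 2 i

theorem truncTrace_sq {R : Type*} [CommRing R] [CharP R 2] (n : ℕ) (x : R) :
    truncTrace n (x ^ 2) = truncTrace n x ^ 2 := by
  have : Fact (Nat.Prime 2) := ⟨Nat.prime_two⟩
  simp only [truncTrace]
  rw [sum_pow_char 2]
  exact sum_congr rfl fun i _ => by rw [← pow_mul, ← pow_mul, mul_comm]

theorem exists_artinSchreier_or_truncTrace_eq_one {F : Type*} [Field F] [Fintype F] [CharP F 2]
    {m : ℕ} (hq : Fintype.card F = 2 ^ (m + 1)) (x : F) :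
    (∃ y, x = y ^ 2 + y) ∧ truncTrace (m + 1) x = 0 ∨
      (¬ ∃ y, x = y ^ 2 + y) ∧ truncTrace (m + 1) x = 1 := by
  classical
  have hsq : ∀ y : F, truncTrace (m + 1) y ^ 2 = truncTrace (m + 1) y := by
    intro y
    have h := truncTrace_sq_add (m + 1) y
    have h' : truncTrace (m + 2) y = truncTrace (m + 1) y + y := by
      rw [truncTrace, sum_range_succ, ← hq, FiniteField.pow_card, truncTrace]
    rw [h'] at h
    exact add_right_cancel h
  have hzero : ∀ y : F, truncTrace (m + 1) (y ^ 2 + y) = 0 := by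
    intro y
    rw [truncTrace_add, truncTrace_sq, hsq, CharTwo.add_self_eq_zero]
  by_cases hx : ∃ y, x = y ^ 2 + y
  · refine Or.inl ⟨hx, ?_⟩
    obtain ⟨y, rfl⟩ := hx
    exact hzero y
  · refine Or.inr ⟨hx, ?_⟩
    have h01 : truncTrace (m + 1) x = 0 ∨ truncTrace (m + 1) x = 1 := by
      have : truncTrace (m + 1) x * (truncTrace (m + 1) x - 1) = 0 := by
        linear_combination hsq x
      rcases mul_eq_zero.mp this with h | h
      · exact Or.inl h
      · exact Or.inr (sub_eq_zero.mp h)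
    refine h01.resolve_left fun h0 => ?_
    let I : Finset F := univ.image fun y : F => y ^ 2 + y
    have hI : Fintype.card F ≤ 2 * I.card := by
      rw [← card_univ]
      refine card_le_mul_card_image _ 2 fun b hb => ?_
      obtain ⟨y, -, rfl⟩ := mem_image.mp hb
      refine (card_le_card (t := {y, y + 1}) fun z hz => ?_).trans card_le_two
      have hz := (mem_filter.mp hz).2
      have hz' : (z - y) * (z - (y + 1)) = 0 := by
        linear_combination hz + (y - z * y + y ^ 2 - z) * CharTwo.two_eq_zero (R := F)
      simpa [sub_eq_zero] using hz'
    let p : F[X] := truncTrace (m + 1) X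
    have hpe : ∀ y, p.eval y = truncTrace (m + 1) y := fun y => by
      simp [p, truncTrace, eval_finsetSum]
    have hdlt : (truncTrace m X : F[X]).degree < ((2 ^ m : ℕ) : WithBot ℕ) := by
      refine (degree_sum_le _ _).trans_lt ?_
      rw [Finset.sup_lt_iff (WithBot.bot_lt_coe _)]
      intro i hi
      rw [degree_X_pow]
      exact_mod_cast Nat.pow_lt_pow_right one_lt_two (mem_range.mp hi)
    have hps : p = X ^ 2 ^ m + truncTrace m X := by
      simp only [p, truncTrace]
      rw [sum_range_succ, add_comm]
    have hpm : p.Monic := hps ▸ monic_X_pow_add hdlt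
    have hpd : p.natDegree = 2 ^ m := by
      refine natDegree_eq_of_degree_eq_some ?_
      rw [hps, degree_add_eq_left_of_degree_lt (by rwa [degree_X_pow]), degree_X_pow]
    have hxI : x ∉ I := fun h => by
      obtain ⟨y, -, rfl⟩ := mem_image.mp h
      exact hx ⟨y, rfl⟩
    have hsub : (insert x I).card ≤ p.natDegree := by
      refine card_le_degree_of_subset_roots fun z hz => ?_
      rw [mem_roots hpm.ne_zero, IsRoot, hpe]
      rcases Multiset.mem_ndinsert.mp hz with rfl | hz
      · exact h0
      · obtain ⟨y, -, rfl⟩ := mem_image.mp hz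
        exact hzero y
    rw [card_insert_of_notMem hxI, hpd] at hsub
    rw [hq, pow_succ] at hI
    omega

/-- In characteristic two, the trace of `x + x⁻¹` is one for at most `3 * q / 4 + 1`
nonzero `x`. -/
theorem card_le_of_truncTrace_add_inv_eq_one {F : Type*} [Field F] [Fintype F] [CharP F 2]
    {m : ℕ} (hq : Fintype.card F = 2 ^ (m + 2)) (S : Finset F)
    (hS : ∀ x ∈ S, x ≠ 0 ∧ truncTrace (m + 2) x + truncTrace (m + 2) x⁻¹ = 1) :
    S.card ≤ 3 * 2 ^ m + 1 := by
  have : Fact (Nat.Prime 2) := ⟨Nat.prime_two⟩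
  set g := 2 ^ m with hg
  have hg1 : 1 ≤ g := Nat.one_le_two_pow
  let V : F[X] := ∑ i ∈ range (m + 1), X ^ (g - 2 ^ i)
  let R : F[X] := X ^ (g + 1) * (1 + truncTrace (m + 1) X) + X * V + X ^ (3 * g)
  let Q : F[X] := X ^ (3 * g + 1) + R
  have hUd : (1 + truncTrace (m + 1) X : F[X]).natDegree ≤ g := by
    refine natDegree_add_le_of_degree_le (by simp) ?_
    refine natDegree_sum_le_of_forall_le _ _ fun i hi => ?_
    rw [natDegree_X_pow]
    exact Nat.pow_le_pow_right two_pos (Nat.lt_succ_iff.mp (mem_range.mp hi))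
  have hVd : V.natDegree ≤ g := by
    refine natDegree_sum_le_of_forall_le _ _ fun i _ => ?_
    rw [natDegree_X_pow]
    exact Nat.sub_le _ _
  have hRd : R.natDegree ≤ 3 * g := by
    refine natDegree_add_le_of_degree_le (natDegree_add_le_of_degree_le ?_ ?_)
      (natDegree_X_pow_le _)
    · exact (natDegree_mul_le_of_le (natDegree_X_pow_le _) hUd).trans (by omega)
    · exact (natDegree_mul_le_of_le natDegree_X_le hVd).trans (by omega)
  have hRd' : R.degree < ((3 * g + 1 : ℕ) : WithBot ℕ) :=
    (natDegree_le_iff_degree_le.mp hRd).trans_lt (by exact_mod_cast Nat.lt_succ_self _)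
  have hQm : Q.Monic := monic_X_pow_add hRd'
  have hQd : Q.natDegree = 3 * g + 1 := by
    refine natDegree_eq_of_degree_eq_some ?_
    rw [degree_add_eq_left_of_degree_lt (by rwa [degree_X_pow]), degree_X_pow]
  rw [← hQd]
  refine card_le_degree_of_subset_roots fun x hx => ?_
  rw [mem_roots hQm.ne_zero, IsRoot]
  obtain ⟨hx0, hx⟩ := hS x hx
  have hVe : V.eval x = x ^ g * truncTrace (m + 1) x⁻¹ := by
    simp only [V, truncTrace, eval_finsetSum, eval_pow, eval_X, mul_sum]
    refine sum_congr rfl fun i hi => ?_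
    rw [inv_pow, pow_sub₀ _ hx0]
    exact Nat.pow_le_pow_right two_pos (Nat.lt_succ_iff.mp (mem_range.mp hi))
  have hUe : (truncTrace (m + 1) X : F[X]).eval x = truncTrace (m + 1) x := by
    simp [truncTrace, eval_finsetSum]
  have hQe : Q.eval x = x ^ g * (x * (1 + truncTrace (m + 1) x + truncTrace (m + 1) x⁻¹)
      + x ^ (2 * g) * (x + 1)) := by
    simp only [Q, R, eval_add, eval_mul, eval_pow, eval_X, hVe, hUe, eval_one]
    ring
  rw [hQe]
  refine mul_eq_zero_of_right _ (pow_eq_zero_iff two_ne_zero |>.mp ?_)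
  have hxq : (x ^ (2 * g)) ^ 2 = x := by
    rw [← pow_mul]
    have : 2 * g * 2 = Fintype.card F := by
      rw [hq, hg]
      ring
    rw [this, FiniteField.pow_card]
  rw [← truncTrace_sq_add (m + 1), ← truncTrace_sq_add (m + 1)] at hx
  have hxi : x * x⁻¹ = 1 := mul_inv_cancel₀ hx0
  have h2 : (2 : F) = 0 := CharTwo.two_eq_zero
  rw [add_pow_char, mul_pow, mul_pow, add_pow_char, add_pow_char, add_pow_char, hxq]
  linear_combination x ^ 2 * hx - x * hxi + x ^ 2 * h2

theorem card_Tplus_of_charP_two {F : Type*} [Field F] [Fintype F] [CharP F 2]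
    (hF : 4 ≤ Fintype.card F) (T : Finset F) (hT : ∀ x, x ∈ T ↔ x ∈ Tplus F) :
    Fintype.card F ≤ 8 * T.card + 19 := by
  classical
  obtain ⟨n, -, hn⟩ := FiniteField.card F 2
  obtain ⟨m, hm⟩ : ∃ m, (n : ℕ) = m + 2 := by
    refine Nat.exists_eq_add_of_le' ?_
    by_contra! h
    have : 2 ^ (n : ℕ) ≤ 2 ^ 1 := Nat.pow_le_pow_right two_pos (by omega)
    omega
  rw [hm] at hn
  let S : Finset F :=
    univ.filter fun x => x ≠ 0 ∧ truncTrace (m + 2) x + truncTrace (m + 2) x⁻¹ = 1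
  have hS := card_le_of_truncTrace_add_inv_eq_one hn S fun x hx => (mem_filter.mp hx).2
  have hD := card_le_card_Tplus S T hT fun x hx => by
    rw [mem_filter]
    refine ⟨mem_univ _, ?_, ?_⟩
    · rintro rfl
      simp at hx
    · rcases exists_artinSchreier_or_truncTrace_eq_one hn x with ⟨h1, h1'⟩ | ⟨h1, h1'⟩ <;>
        rcases exists_artinSchreier_or_truncTrace_eq_one hn x⁻¹ with ⟨h3, h3'⟩ | ⟨h3, h3'⟩ <;>
        simp [h1', h3'] <;> tauto
  have : 2 ^ (m + 2) = 4 * 2 ^ m := by ring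
  omega

theorem exists_Tplus_add_add_mul_of_fintype {F : Type*} [Field F] [Fintype F]
    (hF : 100000 ≤ Fintype.card F) (x : F) :
    ∃ a ∈ Tplus F, ∃ b ∈ Tplus F, ∃ c ∈ Tplus F, ∃ d ∈ Tplus F, x = a + b + c * d := by
  classical
  let T : Finset F := univ.filter (· ∈ Tplus F)
  have hT : ∀ x, x ∈ T ↔ x ∈ Tplus F := fun x => by simp [T]
  have hcard : Fintype.card F ≤ 8 * T.card + 19 := by
    by_cases h2 : ringChar F = 2
    · have : CharP F 2 := ringChar.of_eq h2
      exact card_Tplus_of_charP_two (by omega) T hT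
    · exact card_Tplus_of_ringChar_ne_two h2 T hT
  have hlt : Fintype.card F ^ 3 < T.card ^ 4 := by
    have h16 : Fintype.card F ≤ 16 * T.card := by omega
    have h4 := Nat.pow_le_pow_left h16 4
    rw [mul_pow] at h4
    have h3 : 100000 * Fintype.card F ^ 3 ≤ Fintype.card F ^ 4 := by
      rw [pow_succ _ 3, mul_comm]
      gcongr
    have : 0 < Fintype.card F ^ 3 := by positivity
    norm_num at h4
    omega
  simpa only [hT] using exists_add_add_mul_of_card_pow_lt T hlt x

end ArtinSchreier

section Transfer

theorem mem_Tplus_iff {F : Type*} [Field F] (x : F) :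
    x ∈ Tplus F ↔ ∀ y, ¬ x = y * y + y ∧ ¬ 1 = x * (y * y + y) := by
  constructor
  · rintro ⟨h0, h1, h2⟩ y
    refine ⟨fun h => h1 ⟨y, by rw [h, sq]⟩, fun h => h2 ⟨y, ?_⟩⟩
    rw [sq]
    exact inv_eq_of_mul_eq_one_right h.symm
  · intro h
    have h0 : x ≠ 0 := by
      rintro rfl
      exact (h 0).1 (by simp)
    refine ⟨h0, ?_, ?_⟩
    · rintro ⟨y, hy⟩
      exact (h y).1 (by rw [hy, sq])
    · rintro ⟨y, hy⟩
      refine (h y).2 ?_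
      rw [← sq, ← hy, mul_inv_cancel₀ h0]

/-- The part of `sumsOfTplusSentence` saying that the `i`-th variable is neither `y ^ 2 + y` nor
the inverse of such an element, where `y` is the last variable. -/
def notArtinSchreierFormula (i : Fin 6) : Language.ring.BoundedFormula Empty 6 :=
  ∼(&i =' (&5 * &5 + &5)) ⊓ ∼((1 : Language.ring.Term (Empty ⊕ Fin 6)) =' (&i * (&5 * &5 + &5)))

/-- The sentence saying that every element is of the form `a + b + c * d` with `a`, `b`, `c`, `d`
in `Tplus`. -/
def sumsOfTplusSentence : Language.ring.Sentence :=
  ∀' ∃' ∃' ∃' ∃' (((&0 : Language.ring.Term (Empty ⊕ Fin 5)) =' (&1 + &2 + &3 * &4)) ⊓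
    ∀' (notArtinSchreierFormula 1 ⊓ notArtinSchreierFormula 2 ⊓
      notArtinSchreierFormula 3 ⊓ notArtinSchreierFormula 4))

theorem ringSat_sumsOfTplusSentence_iff (F : Type*) [Field F] :
    RingSat F sumsOfTplusSentence ↔ ∀ x : F,
      ∃ a ∈ Tplus F, ∃ b ∈ Tplus F, ∃ c ∈ Tplus F, ∃ d ∈ Tplus F, x = a + b + c * d := by
  let := FirstOrder.Ring.compatibleRingOfRing F
  simp only [mem_Tplus_iff]
  unfold RingSat
  simp [sumsOfTplusSentence, notArtinSchreierFormula, Sentence.Realize, Formula.Realize, Fin.snoc]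
  refine forall_congr' fun x => ⟨?_, ?_⟩
  · rintro ⟨a, b, c, d, hx, h⟩
    exact ⟨a, fun y => (h y).1.1.1, b, fun y => (h y).1.1.2, c, fun y => (h y).1.2, d,
      fun y => (h y).2, hx⟩
  · rintro ⟨a, ha, b, hb, c, hc, d, hd, hx⟩
    exact ⟨a, b, c, d, hx, fun y => ⟨⟨⟨ha y, hb y⟩, hc y⟩, hd y⟩⟩

theorem ringSat_cardGe_imp_iff (F : Type*) [Field F] (n : ℕ) (σ : Language.ring.Sentence) :
    RingSat F ((Sentence.cardGe Language.ring n).imp σ) ↔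
      ((n : Cardinal) ≤ Cardinal.mk F → RingSat F σ) := by
  let := FirstOrder.Ring.compatibleRingOfRing F
  unfold RingSat
  rw [← Sentence.realize_cardGe Language.ring]
  exact Formula.realize_imp

theorem exists_Tplus_add_add_mul {k : Type*} [Field k] (hk : ModelOfTheoryOfFiniteFields k)
    (hcard : ((100000 : ℕ) : Cardinal) ≤ Cardinal.mk k) (x : k) :
    ∃ a ∈ Tplus k, ∃ b ∈ Tplus k, ∃ c ∈ Tplus k, ∃ d ∈ Tplus k, x = a + b + c * d := by
  have h := hk ((Sentence.cardGe Language.ring 100000).imp sumsOfTplusSentence) fun F _ _ => by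
    rw [ringSat_cardGe_imp_iff, ringSat_sumsOfTplusSentence_iff, Cardinal.mk_fintype]
    exact fun hF => exists_Tplus_add_add_mul_of_fintype (by exact_mod_cast hF)
  rw [ringSat_cardGe_imp_iff, ringSat_sumsOfTplusSentence_iff] at h
  exact h hcard x

end Transfer

section Lifting

variable {K : Type*} [Field K] (A : ValuationSubring K)

theorem ValuationSubring.exists_artinSchreier_of_residue_eq_zero [HenselianLocalRing A] {x : A}
    (hx : IsLocalRing.residue A x = 0) : ∃ y : K, (x : K) = y ^ 2 + y := by
  have hx : x ∈ IsLocalRing.maximalIdeal A := (IsLocalRing.residue_eq_zero_iff x).mp hx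
  open Polynomial in
  obtain ⟨y, hy, -⟩ := HenselianLocalRing.is_henselian (X ^ 2 + (X - C x) : A[X])
    (monic_X_pow_add (by rw [degree_X_sub_C]; norm_num)) 0 (by simpa using hx) (by simp)
  simp only [Polynomial.IsRoot, Polynomial.eval_add, Polynomial.eval_pow, Polynomial.eval_X,
    Polynomial.eval_sub, Polynomial.eval_C] at hy
  refine ⟨y, ?_⟩
  have := congrArg (Subtype.val : A → K) hy
  push_cast at this
  linear_combination -this

theorem ValuationSubring.mem_of_sq_add_mem {y : K} (hy : y ^ 2 + y ∈ A) : y ∈ A := by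
  by_contra h
  have hi : y⁻¹ ∈ A := (A.mem_or_inv_mem y).resolve_left h
  have hy0 : y ≠ 0 := by
    rintro rfl
    exact h A.zero_mem
  refine h ?_
  have : y = (y ^ 2 + y) * y⁻¹ - 1 := by
    field_simp
    ring
  rw [this]
  exact sub_mem (A.mul_mem _ _ hy hi) A.one_mem

theorem ValuationSubring.mem_of_mem_Tplus [HenselianLocalRing A] {x : K} (hx : x ∈ Tplus K) :
    x ∈ A := by
  obtain ⟨h0, -, h⟩ := hx
  by_contra hxA
  have hi : x⁻¹ ∈ A := (A.mem_or_inv_mem x).resolve_left hxA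
  refine h (A.exists_artinSchreier_of_residue_eq_zero (x := ⟨x⁻¹, hi⟩) ?_)
  rw [IsLocalRing.residue_eq_zero_iff, IsLocalRing.mem_maximalIdeal, _root_.mem_nonunits_iff]
  intro hu
  obtain ⟨b, hb⟩ := hu.exists_right_inv
  refine hxA ?_
  have hb := congrArg (Subtype.val : A → K) hb
  have : x = b := by
    rw [← inv_inv x]
    exact inv_eq_of_mul_eq_one_right hb
  rw [this]
  exact b.2

theorem ValuationSubring.not_exists_artinSchreier_of_residue [IsLocalRing A] {x : A}
    (hx : ¬ ∃ y, IsLocalRing.residue A x = y ^ 2 + y) : ¬ ∃ y : K, (x : K) = y ^ 2 + y := by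
  rintro ⟨y, hy⟩
  have hyA : y ∈ A := A.mem_of_sq_add_mem (hy ▸ x.2)
  refine hx ⟨IsLocalRing.residue A ⟨y, hyA⟩, ?_⟩
  rw [← map_pow, ← map_add]
  exact congrArg _ (Subtype.ext hy)

theorem ValuationSubring.mem_Tplus_of_residue_mem_Tplus [IsLocalRing A] {x : A}
    (hx : IsLocalRing.residue A x ∈ Tplus (IsLocalRing.ResidueField A)) : (x : K) ∈ Tplus K := by
  obtain ⟨h0, h1, h2⟩ := hx
  obtain ⟨u, rfl⟩ := (IsLocalRing.residue_ne_zero_iff_isUnit x).mp h0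
  have hinv : ((u : A) : K)⁻¹ = ((u⁻¹ : Aˣ) : A) := by
    refine inv_eq_of_mul_eq_one_right ?_
    exact congrArg (Subtype.val : A → K) u.mul_inv
  refine ⟨?_, A.not_exists_artinSchreier_of_residue h1, ?_⟩
  · intro h
    exact u.ne_zero (Subtype.ext h)
  · rw [hinv]
    refine A.not_exists_artinSchreier_of_residue ?_
    rwa [map_units_inv]

end Lifting

/-- There is a positive integer `N` such that for every Henselian valued field
`K` whose residue field is a model of the theory of finite fields and has at least `N` elements,
the valuation ring is exactly `{a + b + c·d : a, b, c, d ∈ T⁺(K)}`. -/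
theorem valuation_ring_eq_sums_of_tplus :
    ∃ N : ℕ, 0 < N ∧
      ∀ (K : Type u) (Γ₀ : Type v) (_ : Field K) (_ : LinearOrderedCommGroupWithZero Γ₀)
        (v : Valuation K Γ₀) (_ : HenselianLocalRing v.valuationSubring),
        ModelOfTheoryOfFiniteFields (IsLocalRing.ResidueField v.valuationSubring) →
        (N : Cardinal) ≤ Cardinal.mk (IsLocalRing.ResidueField v.valuationSubring) →
        {x : K | v x ≤ 1} =
          {x : K | ∃ a ∈ Tplus K, ∃ b ∈ Tplus K, ∃ c ∈ Tplus K, ∃ d ∈ Tplus K,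
            x = a + b + c * d} := by
  refine ⟨100000, by norm_num, fun K Γ₀ _ _ v _ hk hcard => ?_⟩
  ext x
  constructor
  · intro hx
    let x' : v.valuationSubring := ⟨x, hx⟩
    obtain ⟨a, ha, b, hb, c, hc, d, hd, h⟩ :=
      exists_Tplus_add_add_mul hk hcard (IsLocalRing.residue _ x')
    obtain ⟨b, rfl⟩ := IsLocalRing.residue_surjective b
    obtain ⟨c, rfl⟩ := IsLocalRing.residue_surjective c
    obtain ⟨d, rfl⟩ := IsLocalRing.residue_surjective d
    refine ⟨(x' - b - c * d : v.valuationSubring),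
      v.valuationSubring.mem_Tplus_of_residue_mem_Tplus ?_,
      b, v.valuationSubring.mem_Tplus_of_residue_mem_Tplus hb,
      c, v.valuationSubring.mem_Tplus_of_residue_mem_Tplus hc,
      d, v.valuationSubring.mem_Tplus_of_residue_mem_Tplus hd, ?_⟩
    · rw [map_sub, map_sub, map_mul, h]
      convert ha using 1
      ring
    · push_cast
      ring
  · rintro ⟨a, ha, b, hb, c, hc, d, hd, rfl⟩
    have hmem : ∀ y ∈ Tplus K, y ∈ v.valuationSubring := fun y hy =>
      v.valuationSubring.mem_of_mem_Tplus hy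
    exact add_mem (add_mem (hmem a ha) (hmem b hb)) (mul_mem (hmem c hc) (hmem d hd))
end

section
/- Let K be a Henselian valued field whose residue field is a model of the theory of finite fields, and let Δ ⊆ Γ be convex. Suppose a, b, c, d, x ∈ K satisfy T_Δ(a), T_Δ(b), T_Δ(c), T_Δ(d), and suppose there exist w ∈ K and u₁, u₂, u₃, u₄ ∈ 1 + M_Δ with w = a·u₁ + b·u₂ and x = w·u₃ + c·d·u₄ (i.e., the hyperfield K/(1+M_Δ) satisfies Σ₃ applied to the cosets of a, b, c·d, x). Then v(x) ≥ 0. -/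
open FirstOrder Language

/-- `Δ ⊆ Γ₀` is (the multiplicative rendering of) a convex subset of the value group `Γ`
containing `0`: written multiplicatively, `1 ∈ Δ`, `0 ∉ Δ` (so `Δ` consists of group
elements), and `Δ` is upward closed (additively: downward closed). -/
def IsConvexSubset {Γ₀ : Type*} [LinearOrderedCommGroupWithZero Γ₀] (Δ : Set Γ₀) : Prop :=
  (1 : Γ₀) ∈ Δ ∧ (0 : Γ₀) ∉ Δ ∧ ∀ a b : Γ₀, a ∈ Δ → a ≤ b → b ∈ Δ

/-- `MDelta v Δ = {x ∈ K : v(x) > δ for all δ ∈ Δ}` (multiplicatively: `v x < δ`). -/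
def MDelta {K Γ₀ : Type*} [Field K] [LinearOrderedCommGroupWithZero Γ₀]
    (v : Valuation K Γ₀) (Δ : Set Γ₀) : Set K :=
  {x | ∀ δ ∈ Δ, v x < δ}

/-- The coset `1 + M_Δ`. -/
def oneAddMDelta {K Γ₀ : Type*} [Field K] [LinearOrderedCommGroupWithZero Γ₀]
    (v : Valuation K Γ₀) (Δ : Set Γ₀) : Set K :=
  {u | ∃ m ∈ MDelta v Δ, u = 1 + m}

/-- `x` satisfies `AS_Δ`: the coset of `x` in `K/(1+M_Δ)` is an Artin–Schreier value
(`P₂^{AS,Kras}`). -/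
def ASDelta {K Γ₀ : Type*} [Field K] [LinearOrderedCommGroupWithZero Γ₀]
    (v : Valuation K Γ₀) (Δ : Set Γ₀) (x : K) : Prop :=
  ∃ (y u₁ u₂ : K), u₁ ∈ oneAddMDelta v Δ ∧ u₂ ∈ oneAddMDelta v Δ ∧ x = y ^ 2 * u₁ + y * u₂

/-- `x` satisfies `T_Δ` (the condition `T^{+,Kras}` on the coset of `x`). -/
def TDelta {K Γ₀ : Type*} [Field K] [LinearOrderedCommGroupWithZero Γ₀]
    (v : Valuation K Γ₀) (Δ : Set Γ₀) (x : K) : Prop :=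
  x ≠ 0 ∧ ¬ ASDelta v Δ x ∧ ¬ ASDelta v Δ x⁻¹

open Polynomial in
/-- Over a Henselian local ring, every element of the maximal ideal is of the form `y ^ 2 + y`. -/
theorem HenselianLocalRing.exists_sq_add_self_eq {R : Type*} [CommRing R] [HenselianLocalRing R]
    {a : R} (ha : a ∈ IsLocalRing.maximalIdeal R) : ∃ y : R, y ^ 2 + y = a := by
  have hm : (X ^ 2 + X - C a : R[X]).Monic := by
    nontriviality R
    monicity!
  obtain ⟨y, hy, -⟩ := HenselianLocalRing.is_henselian (X ^ 2 + X - C a : R[X]) hm 0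
    (by simpa using ha) (by simp)
  exact ⟨y, by simpa [IsRoot, sub_eq_zero] using hy⟩

section

variable {K Γ₀ : Type*} [Field K] [LinearOrderedCommGroupWithZero Γ₀]
  (v : Valuation K Γ₀) {Δ : Set Γ₀}

theorem one_mem_oneAddMDelta (h0 : (0 : Γ₀) ∉ Δ) : (1 : K) ∈ oneAddMDelta v Δ :=
  ⟨0, fun δ hδ => by
    rw [map_zero]
    exact zero_lt_iff.2 fun h => h0 (h ▸ hδ), by simp⟩

theorem map_le_one_of_mem_oneAddMDelta (h1 : (1 : Γ₀) ∈ Δ) {u : K}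
    (hu : u ∈ oneAddMDelta v Δ) : v u ≤ 1 := by
  obtain ⟨m, hm, rfl⟩ := hu
  exact v.map_add_le v.map_one.le (hm 1 h1).le

/-- In a Henselian valued field every element of the maximal ideal is an Artin–Schreier value. -/
theorem ASDelta.of_map_lt_one [HenselianLocalRing v.valuationSubring] (h0 : (0 : Γ₀) ∉ Δ)
    {a : K} (ha : v a < 1) : ASDelta v Δ a := by
  have hmem : (⟨a, ha.le⟩ : v.valuationSubring) ∈ IsLocalRing.maximalIdeal v.valuationSubring := by
    rw [IsLocalRing.mem_maximalIdeal, mem_nonunits_iff]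
    intro hu
    obtain ⟨b, hb⟩ := hu.exists_right_inv
    have hab : a * (b : K) = 1 := congrArg Subtype.val hb
    have hvb : v (b : K) ≤ 1 := b.2
    have := mul_lt_one_of_lt_of_le ha hvb
    rw [← map_mul, hab, map_one] at this
    exact this.false
  obtain ⟨y, hy⟩ := HenselianLocalRing.exists_sq_add_self_eq hmem
  have hy' : (y : K) ^ 2 + (y : K) = a := congrArg Subtype.val hy
  exact ⟨y, 1, 1, one_mem_oneAddMDelta v h0, one_mem_oneAddMDelta v h0, by simp [hy']⟩

/-- In a Henselian valued field the elements satisfying `TDelta` are units of the valuation ring. -/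
theorem TDelta.map_eq_one [HenselianLocalRing v.valuationSubring] (h0 : (0 : Γ₀) ∉ Δ)
    {a : K} (ha : TDelta v Δ a) : v a = 1 := by
  obtain ⟨hne, h₁, h₂⟩ := ha
  refine le_antisymm ?_ (not_lt.1 fun h => h₁ (.of_map_lt_one v h0 h))
  by_contra! h
  exact h₂ (.of_map_lt_one v h0 (by rw [map_inv₀]; exact inv_lt_one_of_one_lt₀ h))

end

/-- Henselian `K` with residue field a model of the theory of finite fields,
`Δ` convex, `T_Δ(a), T_Δ(b), T_Δ(c), T_Δ(d)`, and the hyperfield `K/(1+M_Δ)` satisfies `Σ₃`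
applied to the cosets of `a, b, c·d, x` (i.e. `w = a·u₁ + b·u₂`, `x = w·u₃ + c·d·u₄` for some
`w` and units `uᵢ ∈ 1+M_Δ`).  Then `v x ≥ 0` (multiplicatively `v x ≤ 1`). -/
theorem sigma3_tplus_nonneg {K : Type*} [Field K] {Γ₀ : Type*}
    [LinearOrderedCommGroupWithZero Γ₀] (v : Valuation K Γ₀)
    [HenselianLocalRing v.valuationSubring]
    (hk : ModelOfTheoryOfFiniteFields (IsLocalRing.ResidueField v.valuationSubring))
    (Δ : Set Γ₀) (hΔ : IsConvexSubset Δ)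
    (a b c d x : K)
    (ha : TDelta v Δ a) (hb : TDelta v Δ b) (hc : TDelta v Δ c) (hd : TDelta v Δ d)
    (h : ∃ (w u₁ u₂ u₃ u₄ : K), u₁ ∈ oneAddMDelta v Δ ∧ u₂ ∈ oneAddMDelta v Δ ∧
      u₃ ∈ oneAddMDelta v Δ ∧ u₄ ∈ oneAddMDelta v Δ ∧
      w = a * u₁ + b * u₂ ∧ x = w * u₃ + c * d * u₄) :
    v x ≤ 1 := by
  obtain ⟨h1, h0, -⟩ := hΔ
  obtain ⟨w, u₁, u₂, u₃, u₄, hu₁, hu₂, hu₃, hu₄, rfl, rfl⟩ := h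
  have hu {u : K} (h : u ∈ oneAddMDelta v Δ) := map_le_one_of_mem_oneAddMDelta v h1 h
  refine v.map_add_le ?_ ?_
  · rw [map_mul]
    refine mul_le_one' (v.map_add_le ?_ ?_) (hu hu₃)
    · simpa [ha.map_eq_one v h0] using hu hu₁
    · simpa [hb.map_eq_one v h0] using hu hu₂
  · simpa [hc.map_eq_one v h0, hd.map_eq_one v h0] using hu hu₄
end

section
/- Let K be a Henselian valued field whose residue field is a model of the theory of finite fields, let Δ ⊆ Γ be convex, and let l ≥ 1 be an integer. Suppose x, y, w ∈ K satisfy T_Δ(y) and T_Δ(w), and suppose there exist ρ ∈ K and u₁, u₂, u₃, u₄ ∈ 1 + M_Δ with ρ = x^l·u₁ − u₂ and w = ρ·u₃ + y·u₄ (i.e., the hyperfield K/(1+M_Δ) satisfies Σ₃ applied to the cosets of x^l, −1, y, w). Then v(x) ≥ 0. -/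
open FirstOrder Language

/-- Artin–Schreier values: by Hensel's lemma every element of the maximal ideal has the form
`a ^ 2 + a`. -/
lemma exists_sq_add_self_eq_of_valuation_lt_one {K : Type*} [Field K] {Γ₀ : Type*}
    [LinearOrderedCommGroupWithZero Γ₀] (v : Valuation K Γ₀)
    [HenselianLocalRing v.valuationSubring] {z : K} (hz : v z < 1) :
    ∃ a : K, z = a ^ 2 + a := by
  let c : v.valuationSubring := ⟨z, hz.le⟩
  have hc : c ∈ IsLocalRing.maximalIdeal v.valuationSubring := by
    rw [IsLocalRing.mem_maximalIdeal, mem_nonunits_iff]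
    intro hu
    obtain ⟨b, hb⟩ := isUnit_iff_exists_inv.mp hu
    have hzb : z * (b : K) = 1 := congrArg Subtype.val hb
    have hvb : v (b : K) ≤ 1 := b.2
    have hlt : v z * v (b : K) < 1 := (mul_le_of_le_one_right' hvb).trans_lt hz
    rw [← map_mul, hzb, map_one] at hlt
    exact lt_irrefl _ hlt
  let f : Polynomial v.valuationSubring :=
    Polynomial.X ^ 2 + Polynomial.X - Polynomial.C c
  have hf : f.Monic := by
    simp only [f]
    monicity!
  obtain ⟨a, ha, -⟩ := HenselianLocalRing.is_henselian f hf 0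
    (by simpa [f] using hc) (by simp [f])
  refine ⟨a, ?_⟩
  have hac : a ^ 2 + a - c = 0 := by simpa [f, Polynomial.IsRoot] using ha
  exact (congrArg Subtype.val (sub_eq_zero.mp hac)).symm

lemma one_mem_oneAddMDelta_s7 {K : Type*} [Field K] {Γ₀ : Type*}
    [LinearOrderedCommGroupWithZero Γ₀] (v : Valuation K Γ₀) {Δ : Set Γ₀}
    (hΔ : IsConvexSubset Δ) : (1 : K) ∈ oneAddMDelta v Δ := by
  refine ⟨0, fun δ hδ => ?_, by simp⟩
  rw [map_zero]
  exact zero_lt_iff.mpr fun h => hΔ.2.1 (h ▸ hδ)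

lemma valuation_eq_one_of_mem_oneAddMDelta {K : Type*} [Field K] {Γ₀ : Type*}
    [LinearOrderedCommGroupWithZero Γ₀] (v : Valuation K Γ₀) {Δ : Set Γ₀}
    (hΔ : IsConvexSubset Δ) {u : K} (hu : u ∈ oneAddMDelta v Δ) : v u = 1 := by
  obtain ⟨m, hm, rfl⟩ := hu
  exact v.map_one_add_of_lt (hm 1 hΔ.1)

lemma ASDelta_of_valuation_lt_one {K : Type*} [Field K] {Γ₀ : Type*}
    [LinearOrderedCommGroupWithZero Γ₀] (v : Valuation K Γ₀)
    [HenselianLocalRing v.valuationSubring] {Δ : Set Γ₀} (hΔ : IsConvexSubset Δ)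
    {z : K} (hz : v z < 1) : ASDelta v Δ z := by
  obtain ⟨a, ha⟩ := exists_sq_add_self_eq_of_valuation_lt_one v hz
  exact ⟨a, 1, 1, one_mem_oneAddMDelta_s7 v hΔ, one_mem_oneAddMDelta_s7 v hΔ, by simpa using ha⟩

lemma TDelta.valuation_le_one {K : Type*} [Field K] {Γ₀ : Type*}
    [LinearOrderedCommGroupWithZero Γ₀] {v : Valuation K Γ₀}
    [HenselianLocalRing v.valuationSubring] {Δ : Set Γ₀} (hΔ : IsConvexSubset Δ)
    {z : K} (hz : TDelta v Δ z) : v z ≤ 1 := by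
  by_contra! h
  refine hz.2.2 (ASDelta_of_valuation_lt_one v hΔ ?_)
  rw [map_inv₀]
  exact inv_lt_one_of_one_lt₀ h

/-- Henselian `K` with residue field a model of the theory of finite fields,
`Δ` convex, `l ≥ 1`, `T_Δ(y)` and `T_Δ(w)`, and the hyperfield `K/(1+M_Δ)` satisfies `Σ₃`
applied to the cosets of `x^l, −1, y, w` (i.e. `ρ = x^l·u₁ − u₂`, `w = ρ·u₃ + y·u₄` for some
`ρ` and units `uᵢ ∈ 1+M_Δ`).  Then `v x ≥ 0` (multiplicatively `v x ≤ 1`). -/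
theorem sigma3_power_nonneg {K : Type*} [Field K] {Γ₀ : Type*}
    [LinearOrderedCommGroupWithZero Γ₀] (v : Valuation K Γ₀)
    [HenselianLocalRing v.valuationSubring]
    (hk : ModelOfTheoryOfFiniteFields (IsLocalRing.ResidueField v.valuationSubring))
    (Δ : Set Γ₀) (hΔ : IsConvexSubset Δ)
    (l : ℕ) (hl : 1 ≤ l) (x y w : K)
    (hy : TDelta v Δ y) (hw : TDelta v Δ w)
    (h : ∃ (ρ u₁ u₂ u₃ u₄ : K), u₁ ∈ oneAddMDelta v Δ ∧ u₂ ∈ oneAddMDelta v Δ ∧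
      u₃ ∈ oneAddMDelta v Δ ∧ u₄ ∈ oneAddMDelta v Δ ∧
      ρ = x ^ l * u₁ - u₂ ∧ w = ρ * u₃ + y * u₄) :
    v x ≤ 1 := by
  obtain ⟨ρ, u₁, u₂, u₃, u₄, h₁, h₂, h₃, h₄, hρ, hw'⟩ := h
  replace h₁ := valuation_eq_one_of_mem_oneAddMDelta v hΔ h₁
  replace h₂ := valuation_eq_one_of_mem_oneAddMDelta v hΔ h₂
  replace h₃ := valuation_eq_one_of_mem_oneAddMDelta v hΔ h₃
  replace h₄ := valuation_eq_one_of_mem_oneAddMDelta v hΔ h₄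
  have hvρ : v ρ ≤ 1 := by
    have hsub : v (w - y * u₄) ≤ 1 :=
      v.map_sub_le (hw.valuation_le_one hΔ) (by simpa [h₄] using hy.valuation_le_one hΔ)
    rwa [show w - y * u₄ = ρ * u₃ by rw [hw']; ring, map_mul, h₃, mul_one] at hsub
  have hvx : v (ρ + u₂) ≤ 1 := v.map_add_le hvρ h₂.le
  rw [show ρ + u₂ = x ^ l * u₁ by rw [hρ]; ring, map_mul, h₁, mul_one, map_pow] at hvx
  exact (pow_le_one_iff (Nat.one_le_iff_ne_zero.mp hl)).mp hvx
end

section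
/- Let K be a valued field, Δ ⊆ Γ convex, and a ∈ K with v(a) ≥ 0 and v(a) ∈ Δ. Then for every b ∈ K: b − a ∈ M_Δ if and only if there exists θ ∈ K with b = θ·a and v(θ − 1) > δ − v(a) for every δ ∈ Δ. (Thus the fiber of Ψ_Δ over a + M_Δ consists of the cosets a·θ(1+M_Δ) with θ ∈ 1 + M_{Δ−v(a)}; in particular it is a singleton when v(a) = 0.) -/
/-- Let `K` be a valued field, `Δ` convex, `a ∈ K` with `v a ≥ 0` and
`v a ∈ Δ`.  Then for every `b`: `b − a ∈ M_Δ` iff `b = θ·a` for some `θ` with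
`v(θ − 1) > δ − v(a)` for every `δ ∈ Δ` (multiplicatively `v (θ-1) < δ · (v a)⁻¹`).
(Thus the fiber of `Ψ_Δ` over `a + M_Δ` is `{a·θ(1+M_Δ) : θ ∈ 1 + M_{Δ−v(a)}}`;
in particular a singleton when `v a = 0`.) -/
theorem fiber_of_PsiDelta {K : Type*} [Field K] {Γ₀ : Type*}
    [LinearOrderedCommGroupWithZero Γ₀] (v : Valuation K Γ₀)
    (Δ : Set Γ₀) (hΔ : IsConvexSubset Δ)
    (a : K) (ha : v a ≤ 1) (haΔ : v a ∈ Δ) :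
    ∀ b : K, b - a ∈ MDelta v Δ ↔
      ∃ θ : K, b = θ * a ∧ ∀ δ ∈ Δ, v (θ - 1) < δ * (v a)⁻¹ := by
  intro b
  have hva : v a ≠ 0 := fun h => hΔ.2.1 (h ▸ haΔ)
  have ha0 : a ≠ 0 := v.ne_zero_iff.mp hva
  have key (θ : K) : θ * a - a ∈ MDelta v Δ ↔ ∀ δ ∈ Δ, v (θ - 1) < δ * (v a)⁻¹ := by
    refine forall₂_congr fun δ _ => ?_
    rw [← sub_one_mul, map_mul, ← div_eq_mul_inv, lt_div_iff₀ (zero_lt_iff.mpr hva)]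
  constructor
  · intro h
    have hb : b = b / a * a := (div_mul_cancel₀ b ha0).symm
    exact ⟨b / a, hb, (key _).mp (hb ▸ h)⟩
  · rintro ⟨θ, rfl, h⟩
    exact (key θ).mpr h
end

section
/- Let K be a valued field, Δ ⊆ Γ convex, and x ∈ K. Then x ∈ M_Δ if and only if there exist λ, τ ∈ M_Δ with 1 = x·(1 + λ) + (1 + τ) (i.e., the Krasner hyperfield K/(1+M_Δ) satisfies Σ(1̄, x̄, 1̄); hence the kernel Ψ_Δ⁻¹(0) is definable in the hyperfield by the formula Σ(1, g, 1)). -/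
/-- Let `K` be a valued field, `Δ` convex, and `x ∈ K`.  Then `x ∈ M_Δ` iff
there are `λ, τ ∈ M_Δ` with `1 = x·(1 + λ) + (1 + τ)`, i.e. the Krasner hyperfield
`K/(1+M_Δ)` satisfies `Σ(1̄, x̄, 1̄); hence the kernel `Ψ_Δ⁻¹(0)` is definable in the
hyperfield by the formula `Σ(1, g, 1)`. -/
theorem mem_MDelta_iff_sigma {K : Type*} [Field K] {Γ₀ : Type*}
    [LinearOrderedCommGroupWithZero Γ₀] (v : Valuation K Γ₀)
    (Δ : Set Γ₀) (hΔ : IsConvexSubset Δ) (x : K) :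
    x ∈ MDelta v Δ ↔
      ∃ lam ∈ MDelta v Δ, ∃ tau ∈ MDelta v Δ, (1 : K) = x * (1 + lam) + (1 + tau) := by
  constructor
  · intro hx
    refine ⟨0, fun δ hδ => ?_, -x, fun δ hδ => ?_, by ring⟩
    · rw [map_zero]
      exact zero_lt_iff.2 fun h => hΔ.2.1 (h ▸ hδ)
    · rw [Valuation.map_neg]
      exact hx δ hδ
  · rintro ⟨lam, hlam, tau, htau, h⟩ δ hδ
    have hunit : v (1 + lam) = 1 := v.map_one_add_of_lt (hlam 1 hΔ.1)
    have hmul : x * (1 + lam) = -tau := by linear_combination -h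
    calc v x = v (x * (1 + lam)) := by rw [map_mul, hunit, mul_one]
      _ = v tau := by rw [hmul, Valuation.map_neg]
      _ < δ := htau δ hδ
end

section
/- Let I be a set, i₀ ∈ I, and let Γ* be the restricted product of the lattice-ordered monoids ℤ ∪ {∞} over I, with e the atom at i₀. Then for every h ∈ Γ*: h(w) = 0 for all w ≠ i₀ if and only if h = 0, or (e ≤ h and the order interval [e, h + h] in Γ* is linearly ordered), or (h ≤ −e and the order interval [h + h, −e] in Γ* is linearly ordered). -/
/-- The restricted product `Γ*` of the lattice-ordered monoids `ℤ ∪ {∞}` over `I`: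
functions `h : I → ℤ ∪ {∞}` with `h i < 0` for only finitely many `i`.  (Here `ℤ ∪ {∞}` is
`WithTop ℤ`, with pointwise addition, order and lattice operations.) -/
def GammaStar (I : Type*) : Set (I → WithTop ℤ) :=
  {h | {i | h i < 0}.Finite}

/-- The atom `e` at `i₀`: value `1` at `i₀` and `0` elsewhere. -/
def atomAt {I : Type*} [DecidableEq I] (i₀ : I) : I → WithTop ℤ :=
  fun w => if w = i₀ then 1 else 0

/-- `−e`: value `−1` at `i₀` and `0` elsewhere. -/
def negAtomAt {I : Type*} [DecidableEq I] (i₀ : I) : I → WithTop ℤ :=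
  fun w => if w = i₀ then ((-1 : ℤ) : WithTop ℤ) else 0

/-- The order interval `[a, b]` inside `Γ*` is linearly ordered (with the pointwise order). -/
def IntervalLinearlyOrdered (I : Type*) (a b : I → WithTop ℤ) : Prop :=
  ∀ j ∈ GammaStar I, ∀ k ∈ GammaStar I,
    a ≤ j → j ≤ b → a ≤ k → k ≤ b → j ≤ k ∨ k ≤ j

theorem GammaStar.mem_of_le {I : Type*} {a b : I → WithTop ℤ} (ha : a ∈ GammaStar I)
    (hab : a ≤ b) : b ∈ GammaStar I :=
  Set.Finite.subset ha fun i hi => (hab i).trans_lt hi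

theorem GammaStar.add_mem {I : Type*} {a b : I → WithTop ℤ} (ha : a ∈ GammaStar I)
    (hb : b ∈ GammaStar I) : a + b ∈ GammaStar I := by
  refine (Set.Finite.union ha hb).subset fun i hi => ?_
  by_contra hn
  simp only [Set.mem_union, Set.mem_ofPred_eq, not_or, not_lt] at hn
  exact absurd (add_nonneg hn.1 hn.2) (not_le.mpr hi)

theorem atomAt_mem_gammaStar {I : Type*} [DecidableEq I] (i₀ : I) :
    atomAt i₀ ∈ GammaStar I := by
  refine Set.finite_empty.subset fun i hi => ?_
  simp only [atomAt, Set.mem_ofPred_eq] at hi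
  split_ifs at hi
  · exact absurd hi (by decide)
  · exact absurd hi (lt_irrefl _)

/-- An interval whose endpoints agree away from one coordinate is a chain. -/
theorem intervalLinearlyOrdered_of_eq_off {I : Type*} {a b : I → WithTop ℤ} (i₀ : I)
    (hab : ∀ w, w ≠ i₀ → a w = b w) : IntervalLinearlyOrdered I a b := by
  intro j _ k _ haj hjb hak hkb
  have hjk : ∀ w, w ≠ i₀ → j w = k w := fun w hw =>
    (le_antisymm ((hjb w).trans (hab w hw).ge) (haj w)).trans
      (le_antisymm (hak w) ((hkb w).trans (hab w hw).ge))
  refine (le_total (j i₀) (k i₀)).imp (fun hle w => ?_) fun hle w => ?_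
  all_goals
    by_cases hw : w = i₀
    · exact hw ▸ hle
  · exact (hjk w hw).le
  · exact (hjk w hw).ge

/-- If an interval is a chain, its endpoints differ in at most one coordinate. -/
theorem IntervalLinearlyOrdered.eq_of_ne {I : Type*} [DecidableEq I] {a b : I → WithTop ℤ}
    (hlin : IntervalLinearlyOrdered I a b) (ha : a ∈ GammaStar I) (hab : a ≤ b) {i w : I}
    (hi : a i < b i) (hw : w ≠ i) : a w = b w := by
  have lower : ∀ v, a ≤ Function.update a v (b v) := fun v =>
    le_update_iff.mpr ⟨hab v, fun _ _ => le_rfl⟩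
  have upper : ∀ v, Function.update a v (b v) ≤ b := fun v =>
    update_le_iff.mpr ⟨le_rfl, fun x _ => hab x⟩
  rcases hlin _ (GammaStar.mem_of_le ha (lower i)) _ (GammaStar.mem_of_le ha (lower w))
    (lower i) (upper i) (lower w) (upper w) with hle | hle
  · have := hle i
    rw [Function.update_self, Function.update_of_ne hw.symm] at this
    exact absurd this (not_le.mpr hi)
  · have := hle w
    rw [Function.update_self, Function.update_of_ne hw] at this
    exact le_antisymm (hab w) this

theorem WithTop.eq_zero_of_add_self_eq_zero {x : WithTop ℤ} (hx : x + x = 0) : x = 0 := by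
  induction x with
  | top => simp at hx
  | coe n => norm_cast at hx ⊢; omega

theorem WithTop.one_le_iff_pos {x : WithTop ℤ} : 1 ≤ x ↔ 0 < x := by
  induction x with
  | top => simp
  | coe n => norm_cast

theorem WithTop.le_neg_one_iff_neg {x : WithTop ℤ} : x ≤ ((-1 : ℤ) : WithTop ℤ) ↔ x < 0 := by
  induction x with
  | top => simp
  | coe n => norm_cast; omega

theorem WithTop.one_lt_add_self {x : WithTop ℤ} (hx : 1 ≤ x) : 1 < x + x := by
  induction x with
  | top => exact WithTop.coe_lt_top 1
  | coe n => norm_cast at hx ⊢; omega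

theorem WithTop.add_self_lt_neg_one {x : WithTop ℤ} (hx : x ≤ ((-1 : ℤ) : WithTop ℤ)) :
    x + x < ((-1 : ℤ) : WithTop ℤ) := by
  induction x with
  | top => simp at hx
  | coe n => norm_cast at hx ⊢; omega

/-- For `h ∈ Γ*`: `h(w) = 0` for all `w ≠ i₀` iff `h = 0`, or
(`e ≤ h` and `[e, h + h]` is linearly ordered), or (`h ≤ −e` and `[h + h, −e]` is
linearly ordered), where `e` is the atom at `i₀`. -/
theorem stalk_at_atom_characterization {I : Type*} [DecidableEq I] (i₀ : I)
    (h : I → WithTop ℤ) (hh : h ∈ GammaStar I) :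
    (∀ w : I, w ≠ i₀ → h w = 0) ↔
      h = 0 ∨
      (atomAt i₀ ≤ h ∧ IntervalLinearlyOrdered I (atomAt i₀) (h + h)) ∨
      (h ≤ negAtomAt i₀ ∧ IntervalLinearlyOrdered I (h + h) (negAtomAt i₀)) := by
  constructor
  · intro h0
    rcases lt_trichotomy (h i₀) 0 with hneg | hz | hpos
    · refine Or.inr (Or.inr ⟨fun w => ?_, intervalLinearlyOrdered_of_eq_off i₀ fun w hw => ?_⟩)
      · by_cases hw : w = i₀
        · subst hw
          simpa [negAtomAt] using WithTop.le_neg_one_iff_neg.mpr hneg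
        · simp [negAtomAt, hw, h0 w hw]
      · simp [negAtomAt, hw, h0 w hw]
    · refine Or.inl (funext fun w => ?_)
      by_cases hw : w = i₀
      · exact hw ▸ hz
      · exact h0 w hw
    · refine Or.inr (Or.inl ⟨fun w => ?_, intervalLinearlyOrdered_of_eq_off i₀ fun w hw => ?_⟩)
      · by_cases hw : w = i₀
        · subst hw
          simpa [atomAt] using WithTop.one_le_iff_pos.mpr hpos
        · simp [atomAt, hw, h0 w hw]
      · simp [atomAt, hw, h0 w hw]
  · rintro (rfl | ⟨hle, hlin⟩ | ⟨hle, hlin⟩) w hw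
    · rfl
    · have nonneg : 0 ≤ h := fun v => le_trans (by unfold atomAt; split_ifs <;> simp) (hle v)
      have hi : 1 ≤ h i₀ := by simpa [atomAt] using hle i₀
      have heq := hlin.eq_of_ne (atomAt_mem_gammaStar i₀)
        (hle.trans (le_add_of_nonneg_right nonneg))
        (by simpa [atomAt] using WithTop.one_lt_add_self hi) hw
      simp only [atomAt, if_neg hw, Pi.add_apply] at heq
      exact WithTop.eq_zero_of_add_self_eq_zero heq.symm
    · have hi : h i₀ ≤ ((-1 : ℤ) : WithTop ℤ) := by simpa [negAtomAt] using hle i₀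
      have nonpos : h ≤ 0 := fun v => (hle v).trans <| by
        unfold negAtomAt
        split_ifs
        · exact WithTop.coe_le_coe.mpr (by decide : (-1 : ℤ) ≤ 0)
        · exact le_rfl
      have heq := hlin.eq_of_ne (GammaStar.add_mem hh hh)
        ((add_le_of_nonpos_right nonpos).trans hle)
        (by simpa [negAtomAt] using WithTop.add_self_lt_neg_one hi) hw
      simp only [negAtomAt, if_neg hw, Pi.add_apply] at heq
      exact WithTop.eq_zero_of_add_self_eq_zero heq
end
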